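/- Let (I,g) = (f_1,…,f_n,g) be a generic ideal of type (n+1; d_1,…,d_n,d) in R' = K[x_1,…,x_n,z] with d_1 ≤ ⋯ ≤ d_n ≤ d, and let J = π(I) ⊆ K[x_1,…,x_n] be the image of I = (f_1,…,f_n) under the map sending z to 0. If d ≥ σ and every minimal generator of in(J) satisfies property P with respect to in(J), then every minimal generator of in(I,g) satisfies property P with respect to in(I,g); that is, if Conjecture E holds for J then Conjecture E holds for (I,g). -/

import Mathlib

open MvPolynomial

/-- The total degree of an exponent vector. -/
def expDeg {n : ℕ} (μ : Fin n →₀ ℕ) : ℕ := μ.sum fun _ e => e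

/-- Strict degree reverse lexicographic order on exponent vectors, for variables
`x_1 > ⋯ > x_n` (indexed by `Fin n` in this order). -/
def DrlLT {n : ℕ} (a b : Fin n →₀ ℕ) : Prop :=
  expDeg a < expDeg b ∨
    (expDeg a = expDeg b ∧ ∃ i : Fin n, b i < a i ∧ ∀ j : Fin n, i < j → a j = b j)

/-- `μ` is the leading (degrevlex-largest) exponent of `p`. -/
def IsLeadExp {n : ℕ} {K : Type*} [CommSemiring K] (p : MvPolynomial (Fin n) K)
    (μ : Fin n →₀ ℕ) : Prop :=
  μ ∈ p.support ∧ ∀ ν ∈ p.support, ν ≠ μ → DrlLT ν μ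

/-- The initial ideal of `I` with respect to the degree reverse lexicographic order. -/
noncomputable def initialIdeal {n : ℕ} {K : Type*} [CommRing K]
    (I : Ideal (MvPolynomial (Fin n) K)) : Ideal (MvPolynomial (Fin n) K) :=
  Ideal.span { m | ∃ p ∈ I, p ≠ 0 ∧ ∃ μ, IsLeadExp p μ ∧ m = monomial μ (1 : K) }

/-- The standard monomials of degree `i` of `I` : exponents of the monomials of degree `i`
not lying in the initial ideal of `I`. -/
def stdMon {n : ℕ} {K : Type*} [CommRing K] (I : Ideal (MvPolynomial (Fin n) K)) (i : ℕ) :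
    Set (Fin n →₀ ℕ) :=
  { μ | expDeg μ = i ∧ monomial μ (1 : K) ∉ initialIdeal I }

/-- `μ` is a minimal monomial generator of the monomial ideal `M`. -/
def IsMinGen {n : ℕ} {K : Type*} [CommRing K] (M : Ideal (MvPolynomial (Fin n) K))
    (μ : Fin n →₀ ℕ) : Prop :=
  monomial μ (1 : K) ∈ M ∧ ∀ ν : Fin n →₀ ℕ, ν ≤ μ → ν ≠ μ → monomial ν (1 : K) ∉ M

/-- `μ` satisfies property `P` with respect to the monomial ideal `M`: if `m` is the largest
index of a variable dividing `x^μ`, then every monomial of the same degree in the variables of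
index `< m` also lies in `M`. -/
def SatisfiesP {n : ℕ} {K : Type*} [CommRing K] (M : Ideal (MvPolynomial (Fin n) K))
    (μ : Fin n →₀ ℕ) : Prop :=
  ∀ m : Fin n, μ m ≠ 0 → (∀ j : Fin n, m < j → μ j = 0) →
    ∀ ν : Fin n →₀ ℕ, expDeg ν = expDeg μ → (∀ j : Fin n, m ≤ j → ν j = 0) →
      monomial ν (1 : K) ∈ M

/-- Conjecture E (Pardue) holds for the ideal `I`: every minimal generator of the initial
ideal of `I` satisfies property `P`. -/
def ConjE {n : ℕ} {K : Type*} [CommRing K] (I : Ideal (MvPolynomial (Fin n) K)) : Prop :=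
  ∀ μ, IsMinGen (initialIdeal I) μ → SatisfiesP (initialIdeal I) μ

/-- `f` is a generic sequence of forms of degrees `d i` over the base field `F`: each `f i` is
homogeneous of degree `d i` and the family of all coefficients (at all monomials of degree
`d i`) is algebraically independent over `F`. -/
def IsGenericSeq (F : Type*) {K : Type*} [CommRing F] [CommRing K] [Algebra F K]
    {n r : ℕ} (d : Fin r → ℕ) (f : Fin r → MvPolynomial (Fin n) K) : Prop :=
  (∀ i, (f i).IsHomogeneous (d i)) ∧
    AlgebraicIndependent F
      (fun p : Σ i : Fin r, { μ : Fin n →₀ ℕ // expDeg μ = d i } => (f p.1).coeff p.2.1)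

/-- The projection `K[x_1,…,x_n,z] → K[x_1,…,x_n]` sending `z` (the last variable) to `0` and
fixing the other variables. -/
noncomputable def projMap (K : Type*) [CommRing K] (n : ℕ) :
    MvPolynomial (Fin (n + 1)) K →ₐ[K] MvPolynomial (Fin n) K :=
  aeval (fun i => Fin.lastCases 0 (fun j => X j) i)

/-- Embedding of exponent vectors of `K[x_1,…,x_n]` into those of `K[x_1,…,x_n,z]`
(`z`-exponent `0`). -/
noncomputable def embExp {n : ℕ} (μ : Fin n →₀ ℕ) : Fin (n + 1) →₀ ℕ :=
  Finsupp.embDomain ⟨Fin.castSucc, Fin.castSucc_injective n⟩ μ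

/-- Multiplication by `z^c` on exponent vectors in `K[x_1,…,x_n,z]`. -/
noncomputable def zShift {n : ℕ} (c : ℕ) (μ : Fin (n + 1) →₀ ℕ) : Fin (n + 1) →₀ ℕ :=
  μ + Finsupp.single (Fin.last n) c

/-- `f` (homogeneous of degree `e`) is semi-regular on `R/I`: in each degree `t`, the
multiplication map `(R/I)_t → (R/I)_{t+e}` is injective or surjective. -/
def SemiRegularOn {vars K : Type*} [CommRing K] (I : Ideal (MvPolynomial vars K))
    (f : MvPolynomial vars K) (e : ℕ) : Prop :=
  ∀ t : ℕ,
    (∀ p ∈ homogeneousSubmodule vars K t, f * p ∈ I → p ∈ I) ∨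
    (∀ q ∈ homogeneousSubmodule vars K (t + e),
      ∃ p ∈ homogeneousSubmodule vars K t, q - f * p ∈ I)

/-- The degree-`t` graded piece of `R/I`, as a `K`-submodule of the quotient. -/
noncomputable def quotDegPart {vars K : Type*} [CommRing K] (I : Ideal (MvPolynomial vars K))
    (t : ℕ) : Submodule K (MvPolynomial vars K ⧸ I) :=
  (homogeneousSubmodule vars K t).map (Ideal.Quotient.mkₐ K I).toLinearMap

namespace GenericForms

section Minor

variable {σ S K K₁ : Type*} [CommRing S] [Field K] [Field K₁]

theorem exists_det_coeff_ne_zero {s : ℕ} {v : Fin s → MvPolynomial σ K}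
    (hv : LinearIndependent K v) :
    ∃ μ : Fin s → (σ →₀ ℕ), (Matrix.of fun i j => (v i).coeff (μ j)).det ≠ 0 := by
  classical
  let T : Finset (σ →₀ ℕ) := Finset.univ.biUnion fun j => (v j).support
  let A : Matrix (Fin s) T K := Matrix.of fun j μ => (v j).coeff μ
  have hA : LinearIndependent K A.row := by
    rw [Fintype.linearIndependent_iff] at hv ⊢
    intro c hc
    refine hv c ?_
    ext μ
    by_cases hμ : μ ∈ T
    · simpa [A, coeff_sum, Matrix.row] using congrFun hc ⟨μ, hμ⟩
    · have : ∀ j, (v j).coeff μ = 0 := by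
        intro j
        by_contra h
        exact hμ (Finset.mem_biUnion.2 ⟨j, Finset.mem_univ _, mem_support_iff.2 h⟩)
      simp [coeff_sum, this]
  have hr : A.rank = s := by simpa using hA.rank_matrix
  obtain ⟨κ, a, ha, hspan, hli⟩ := exists_linearIndependent' K A.col
  have : Finite κ := Finite.of_injective a ha
  have : Fintype κ := Fintype.ofFinite κ
  have hcard : Fintype.card κ = s := by
    rw [← finrank_span_eq_card hli, hspan, ← Matrix.rank_eq_finrank_span_cols, hr]
  let e : Fin s ≃ κ := (Fintype.equivFinOfCardEq hcard).symm
  refine ⟨fun j => (a (e j)).1, ?_⟩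
  have h2 : LinearIndependent K
      (Matrix.of fun i j => (v i).coeff (a (e j)).1 : Matrix (Fin s) (Fin s) K).col :=
    hli.comp e e.injective
  rw [Matrix.linearIndependent_cols_iff_isUnit] at h2
  exact ((Matrix.isUnit_iff_isUnit_det _).1 h2).ne_zero

theorem linearIndependent_map_of_linearIndependent_map {Φ : S →+* K} {Ψ : S →+* K₁}
    (hΦ : Function.Injective Φ) {s : ℕ} (p : Fin s → MvPolynomial σ S)
    (h : LinearIndependent K₁ fun j => map Ψ (p j)) :
    LinearIndependent K fun j => map Φ (p j) := by
  obtain ⟨μ, hμ⟩ := exists_det_coeff_ne_zero h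
  have h1 : (Matrix.of fun i j => (p i).coeff (μ j)).det ≠ 0 := by
    intro h0
    apply hμ
    have := congrArg Ψ h0
    rw [RingHom.map_det, map_zero] at this
    rw [← this]
    congr 1
  have h2 : (Matrix.of fun i j => (map Φ (p i)).coeff (μ j)).det ≠ 0 := by
    intro h0
    apply h1
    apply hΦ
    rw [RingHom.map_det, map_zero, ← h0]
    congr 1
  have h3 := Matrix.linearIndependent_rows_of_det_ne_zero h2
  let L : MvPolynomial σ K →ₗ[K] (Fin s → K) := LinearMap.pi fun j => lcoeff K (μ j)
  exact LinearIndependent.of_comp L h3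

end Minor

section Homogeneous

variable {σ k : Type*} [CommRing k]

theorem homogeneousComponent_mul_of_isHomogeneous {g : MvPolynomial σ k} {d : ℕ}
    (hg : g.IsHomogeneous d) (p : MvPolynomial σ k) (i : ℕ) :
    homogeneousComponent (i + d) (p * g) = homogeneousComponent i p * g := by
  have h : p * g = ∑ j ∈ Finset.range (p.totalDegree + 1), homogeneousComponent j p * g := by
    rw [← Finset.sum_mul, sum_homogeneousComponent]
  rw [h, map_sum]
  have h2 : ∀ j, homogeneousComponent (i + d) (homogeneousComponent j p * g) =
      if i = j then homogeneousComponent j p * g else 0 := by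
    intro j
    rw [homogeneousComponent_of_mem ((homogeneousComponent_isHomogeneous j p).mul hg)]
    simp only [add_left_inj]
  simp only [h2, Finset.sum_ite_eq, Finset.mem_range]
  split_ifs with hi
  · rfl
  · rw [homogeneousComponent_eq_zero _ _ (by omega), zero_mul]

theorem homogeneousComponent_mul_of_lt {g : MvPolynomial σ k} {d : ℕ}
    (hg : g.IsHomogeneous d) (p : MvPolynomial σ k) {t : ℕ} (ht : t < d) :
    homogeneousComponent t (p * g) = 0 := by
  have h : p * g = ∑ j ∈ Finset.range (p.totalDegree + 1), homogeneousComponent j p * g := by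
    rw [← Finset.sum_mul, sum_homogeneousComponent]
  rw [h, map_sum]
  refine Finset.sum_eq_zero fun j _ => ?_
  rw [homogeneousComponent_of_mem ((homogeneousComponent_isHomogeneous j p).mul hg)]
  exact if_neg (by omega)

/-- An ideal closed under taking homogeneous components. -/
def IsHomIdeal (I : Ideal (MvPolynomial σ k)) : Prop :=
  ∀ p ∈ I, ∀ t, homogeneousComponent t p ∈ I

theorem isHomIdeal_span {G : Set (MvPolynomial σ k)} (hG : ∀ g ∈ G, ∃ d, g.IsHomogeneous d) :
    IsHomIdeal (Ideal.span G) := by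
  let _ := MvPolynomial.gradedAlgebra (σ := σ) (R := k)
  intro p hp t
  exact homogeneousComponent_mem_of_mem (Ideal.homogeneous_span _ G hG) hp t

theorem IsHomIdeal.sup {I J : Ideal (MvPolynomial σ k)} (hI : IsHomIdeal I)
    (hJ : IsHomIdeal J) : IsHomIdeal (I ⊔ J) := by
  intro p hp t
  obtain ⟨a, ha, b, hb, rfl⟩ := Submodule.mem_sup.1 hp
  rw [map_add]
  exact Submodule.add_mem_sup (hI a ha t) (hJ b hb t)

theorem isHomIdeal_span_singleton {g : MvPolynomial σ k} {d : ℕ} (hg : g.IsHomogeneous d) :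
    IsHomIdeal (Ideal.span {g}) :=
  isHomIdeal_span (by rintro _ rfl; exact ⟨d, hg⟩)

/-- The cofactor of a homogeneous generator can be chosen homogeneous. -/
theorem IsHomIdeal.exists_homogeneous_cofactor {I : Ideal (MvPolynomial σ k)} (hI : IsHomIdeal I)
    {f a : MvPolynomial σ k} {e i : ℕ} (hf : f.IsHomogeneous e) (ha : a.IsHomogeneous i)
    (h : a ∈ I ⊔ Ideal.span {f}) :
    ∃ b : MvPolynomial σ k, b.IsHomogeneous (i - e) ∧ (i < e → b = 0) ∧ a - b * f ∈ I := by
  obtain ⟨u, hu, v, hv, huv⟩ := Submodule.mem_sup.1 h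
  obtain ⟨b, rfl⟩ := Ideal.mem_span_singleton'.1 hv
  have hu' := hI u hu i
  have huv' : homogeneousComponent i u + homogeneousComponent i (b * f) = a := by
    rw [← map_add, huv, homogeneousComponent_eq_self ha]
  by_cases hi : i < e
  · refine ⟨0, isHomogeneous_zero _ _ _, fun _ => rfl, ?_⟩
    rw [homogeneousComponent_mul_of_lt hf b hi, add_zero] at huv'
    simpa [← huv'] using hu'
  · refine ⟨homogeneousComponent (i - e) b, homogeneousComponent_isHomogeneous _ _,
      fun h => absurd h hi, ?_⟩
    have := homogeneousComponent_mul_of_isHomogeneous hf b (i - e)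
    rw [Nat.sub_add_cancel (not_lt.1 hi)] at this
    rw [← this, ← huv', add_sub_cancel_right]
    exact hu'

theorem mem_of_forall_homogeneous {I : Ideal (MvPolynomial σ k)} (hI : IsHomIdeal I)
    {g : MvPolynomial σ k} {d : ℕ} (hg : g.IsHomogeneous d)
    (h : ∀ i, ∀ p : MvPolynomial σ k, p.IsHomogeneous i → g * p ∈ I → p ∈ I)
    (p : MvPolynomial σ k) (hp : g * p ∈ I) : p ∈ I := by
  rw [← sum_homogeneousComponent p]
  refine sum_mem fun i _ => h i _ (homogeneousComponent_isHomogeneous i p) ?_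
  rw [mul_comm, ← homogeneousComponent_mul_of_isHomogeneous hg, mul_comm]
  exact hI _ hp _

end Homogeneous

section Hilbert

variable {σ k : Type*} [Field k]

/-- The degree `t` part of an ideal, as a vector space. -/
noncomputable def idealPart (I : Ideal (MvPolynomial σ k)) (t : ℕ) : Submodule k (MvPolynomial σ k) :=
  I.restrictScalars k ⊓ homogeneousSubmodule σ k t

/-- The dimension of the degree `t` part of an ideal. -/
noncomputable def hilb (I : Ideal (MvPolynomial σ k)) (t : ℕ) : ℕ :=
  Module.finrank k (idealPart I t)

instance finiteDimensional_homogeneousSubmodule [Finite σ] (t : ℕ) :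
    FiniteDimensional k (homogeneousSubmodule σ k t) :=
  Module.Finite.iff_fg.2 (homogeneousSubmodule_fg σ k t)

instance finiteDimensional_idealPart [Finite σ] (I : Ideal (MvPolynomial σ k)) (t : ℕ) :
    FiniteDimensional k (idealPart I t) :=
  Submodule.finiteDimensional_of_le inf_le_right

theorem finrank_map_add_finrank_inf_ker {V W : Type*} [AddCommGroup V] [Module k V]
    [AddCommGroup W] [Module k W] (M : V →ₗ[k] W) (P : Submodule k V) [FiniteDimensional k P] :
    Module.finrank k (P.map M) + Module.finrank k (P ⊓ M.ker : Submodule k V) =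
      Module.finrank k P := by
  have h := (M.domRestrict P).finrank_range_add_finrank_ker
  rw [LinearMap.range_domRestrict] at h
  rw [← h]
  congr 1
  rw [← Submodule.map_comap_subtype P M.ker,
    (Submodule.equivMapOfInjective P.subtype P.injective_subtype _).symm.finrank_eq]
  rfl

/-- The homogeneous elements of degree `i` multiplied into `I` by `g`. -/
noncomputable def colonPart (I : Ideal (MvPolynomial σ k)) (g : MvPolynomial σ k) (i : ℕ) :
    Submodule k (MvPolynomial σ k) :=
  homogeneousSubmodule σ k i ⊓ (I.restrictScalars k).comap (LinearMap.mulLeft k g)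

instance finiteDimensional_colonPart [Finite σ] (I : Ideal (MvPolynomial σ k)) (g : MvPolynomial σ k) (i : ℕ) :
    FiniteDimensional k (colonPart I g i) :=
  Submodule.finiteDimensional_of_le inf_le_left

theorem idealPart_le_colonPart (I : Ideal (MvPolynomial σ k)) (g : MvPolynomial σ k) (i : ℕ) :
    idealPart I i ≤ colonPart I g i :=
  fun _ hp => ⟨hp.2, I.mul_mem_left g hp.1⟩

theorem hilb_sup_span_singleton [Finite σ] {I : Ideal (MvPolynomial σ k)} (hI : IsHomIdeal I)
    {g : MvPolynomial σ k} {d : ℕ} (hg : g.IsHomogeneous d) (i : ℕ) :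
    hilb (I ⊔ Ideal.span {g}) (i + d) + Module.finrank k (colonPart I g i) =
      hilb I (i + d) + Module.finrank k (homogeneousSubmodule σ k i) := by
  have h1 : idealPart (I ⊔ Ideal.span {g}) (i + d) =
      idealPart I (i + d) ⊔ (homogeneousSubmodule σ k i).map (LinearMap.mulLeft k g) := by
    apply le_antisymm
    · rintro p ⟨hp, hpd⟩
      obtain ⟨b, hb, -, hbI⟩ := hI.exists_homogeneous_cofactor hg hpd hp
      rw [Nat.add_sub_cancel] at hb
      rw [← sub_add_cancel p (b * g)]
      refine Submodule.add_mem_sup ⟨hbI, IsHomogeneous.sub hpd (hb.mul hg)⟩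
        ⟨b, hb, by simp [mul_comm]⟩
    · refine sup_le (fun p hp => ⟨Ideal.mem_sup_left hp.1, hp.2⟩) ?_
      rintro _ ⟨b, hb, rfl⟩
      refine ⟨Ideal.mem_sup_right (Ideal.mul_mem_right _ _ (Ideal.mem_span_singleton_self g)), ?_⟩
      rw [add_comm]
      exact hg.mul hb
  have h2 : idealPart I (i + d) ⊓ (homogeneousSubmodule σ k i).map (LinearMap.mulLeft k g) =
      (colonPart I g i).map (LinearMap.mulLeft k g) := by
    ext p
    constructor
    · rintro ⟨hp, b, hb, rfl⟩
      exact ⟨b, ⟨hb, hp.1⟩, rfl⟩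
    · rintro ⟨b, ⟨hb, hbI⟩, rfl⟩
      refine ⟨⟨hbI, ?_⟩, ⟨b, hb, rfl⟩⟩
      rw [add_comm]
      exact hg.mul hb
  have h3 : colonPart I g i ⊓ (LinearMap.mulLeft k g).ker =
      homogeneousSubmodule σ k i ⊓ (LinearMap.mulLeft k g).ker := by
    ext p
    constructor
    · rintro ⟨hp, hk⟩
      exact ⟨hp.1, hk⟩
    · rintro ⟨hp, hk⟩
      refine ⟨⟨hp, ?_⟩, hk⟩
      have : g * p = 0 := hk
      change g * p ∈ I
      rw [this]
      exact I.zero_mem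
  have e1 := Submodule.finrank_sup_add_finrank_inf_eq (idealPart I (i + d))
    ((homogeneousSubmodule σ k i).map (LinearMap.mulLeft k g))
  have e2 := finrank_map_add_finrank_inf_ker (LinearMap.mulLeft k g) (colonPart I g i)
  have e3 := finrank_map_add_finrank_inf_ker (LinearMap.mulLeft k g) (homogeneousSubmodule σ k i)
  rw [h3] at e2
  rw [h2, ← h1] at e1
  unfold hilb
  omega

theorem hilb_sup_span_singleton_of_lt {I : Ideal (MvPolynomial σ k)} (hI : IsHomIdeal I)
    {g : MvPolynomial σ k} {d : ℕ} (hg : g.IsHomogeneous d) {t : ℕ} (ht : t < d) :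
    hilb (I ⊔ Ideal.span {g}) t = hilb I t := by
  have : idealPart (I ⊔ Ideal.span {g}) t = idealPart I t := by
    apply le_antisymm
    · rintro p ⟨hp, hpd⟩
      obtain ⟨b, hb, hb0, hbI⟩ := hI.exists_homogeneous_cofactor hg hpd hp
      rw [hb0 ht, zero_mul, sub_zero] at hbI
      exact ⟨hbI, hpd⟩
    · exact fun p hp => ⟨Ideal.mem_sup_left hp.1, hp.2⟩
  rw [hilb, this, hilb]

theorem finrank_homogeneousSubmodule (t : ℕ) :
    Module.finrank k (homogeneousSubmodule σ k t) = Nat.card {m : σ →₀ ℕ // m.degree = t} := by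
  rw [homogeneousSubmodule_eq_finsupp_supported]
  rw [(AddMonoidAlgebra.supportedEquivFinsupp (S := k) (R := k) {m : σ →₀ ℕ | m.degree = t}).finrank_eq]
  by_cases h : Finite {m : σ →₀ ℕ | m.degree = t}
  · have := Fintype.ofFinite {m : σ →₀ ℕ | m.degree = t}
    rw [Module.finrank_finsupp_self, Nat.card_eq_fintype_card.symm]
    rfl
  · have h' : Infinite {m : σ →₀ ℕ | m.degree = t} := not_finite_iff_infinite.1 h
    have h2 : Nat.card {m : σ →₀ ℕ // m.degree = t} = 0 := @Nat.card_eq_zero_of_infinite _ h'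
    rw [h2, Module.finrank, rank_finsupp_self, Cardinal.toNat_lift]
    exact h2

end Hilbert

section Pencil

variable {K V U : Type*} [Field K] [AddCommGroup V] [Module K V]
  [AddCommGroup U] [Module K U]

theorem exists_ne_zero_forall_add_smul_eq_zero [Infinite K] [FiniteDimensional K V] (X : V →ₗ[K] V) :
    ∃ α : K, α ≠ 0 ∧ ∀ u, u + α • X u = 0 → u = 0 := by
  have hfin : (insert 0 {c : K | Module.End.HasEigenvalue X c} : Set K).Finite :=
    (Module.End.finite_hasEigenvalue X).insert 0
  obtain ⟨c, hc⟩ := hfin.exists_notMem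
  rw [Set.mem_insert_iff, not_or] at hc
  refine ⟨-c⁻¹, by simpa using hc.1, fun u hu => ?_⟩
  by_contra h0
  refine hc.2 (Module.End.hasEigenvalue_of_hasEigenvector (x := u) ⟨?_, h0⟩)
  rw [Module.End.mem_eigenspace_iff]
  rw [neg_smul, add_neg_eq_zero] at hu
  conv_rhs => rw [hu, smul_smul, mul_inv_cancel₀ hc.1, one_smul]

theorem exists_projection_ker (A : V →ₗ[K] U) :
    ∃ π : V →ₗ[K] V, (∀ v, A (π v) = 0) ∧ ∀ v, A v = 0 → π v = v := by
  obtain ⟨π, hπ⟩ := LinearMap.exists_leftInverse_of_injective A.ker.subtype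
    (Submodule.ker_subtype _)
  refine ⟨A.ker.subtype ∘ₗ π, fun v => (π v).2, fun v hv => ?_⟩
  exact congrArg Subtype.val (LinearMap.congr_fun hπ ⟨v, hv⟩)

/-- If `M` is injective from `ker A` to `coker A`, some member of the pencil is injective. -/
theorem exists_injective_add_smul [Infinite K] [FiniteDimensional K V] (A M : V →ₗ[K] U)
    (h : ∀ v w, A v = 0 → M v = A w → v = 0) :
    ∃ α : K, Function.Injective (A + α • M) := by
  obtain ⟨π, hπ0, hπ1⟩ := exists_projection_ker A
  have hT : LinearMap.ker (A + M ∘ₗ π) = ⊥ := by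
    refine LinearMap.ker_eq_bot'.2 fun v hv => ?_
    have hv' : A v + M (π v) = 0 := hv
    have h1 : π v = 0 := h (π v) (-v) (hπ0 v) (by rw [map_neg]; exact eq_neg_of_add_eq_zero_right hv')
    rw [h1, map_zero, add_zero] at hv'
    rw [← hπ1 v hv', h1]
  obtain ⟨P, hP⟩ := LinearMap.exists_leftInverse_of_injective _ hT
  have hP' : ∀ v, P (A v) + P (M (π v)) = v := fun v => by
    simpa using LinearMap.congr_fun hP v
  obtain ⟨α, hα, hX⟩ := exists_ne_zero_forall_add_smul_eq_zero
    (P ∘ₗ M ∘ₗ (LinearMap.id - π))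
  refine ⟨α, (injective_iff_map_eq_zero _).2 fun v hv => ?_⟩
  have hv' : A v + α • M v = 0 := hv
  have hππ : ∀ x, π (π x) = π x := fun x => hπ1 _ (hπ0 x)
  have hu := hX ((v - π v) + α • π v) ?_
  · have h1 : π v = 0 := by
      have := congrArg π hu
      simp only [map_add, map_sub, map_smul, hππ, sub_self, zero_add, map_zero] at this
      exact (smul_eq_zero.1 this).resolve_left hα
    simpa [h1] using hu
  · have e1 := hP' ((v - π v) + α • π v)
    have e2 := congrArg P hv'
    simp only [map_add, map_sub, map_smul, hππ, hπ0, sub_self, zero_add, map_zero, smul_zero,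
      sub_zero, add_zero, LinearMap.comp_apply, LinearMap.sub_apply, LinearMap.id_apply,
      smul_sub] at e1 e2 ⊢
    rw [← e1, ← e2]
    abel

/-- If `M` maps `ker A` onto `coker A`, some member of the pencil is surjective. -/
theorem exists_surjective_add_smul [Infinite K] [FiniteDimensional K U] (A M : V →ₗ[K] U)
    (h : ∀ u, ∃ v w, A w = 0 ∧ u = A v + M w) :
    ∃ α : K, Function.Surjective (A + α • M) := by
  obtain ⟨π, hπ0, hπ1⟩ := exists_projection_ker A
  have hππ : ∀ x, π (π x) = π x := fun x => hπ1 _ (hπ0 x)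
  have hT : LinearMap.range (A + M ∘ₗ π) = ⊤ := by
    refine LinearMap.range_eq_top.2 fun u => ?_
    obtain ⟨v, w, hw, rfl⟩ := h u
    refine ⟨(v - π v) + w, ?_⟩
    simp [hπ0, hππ, hw, hπ1 w hw]
  obtain ⟨P, hP⟩ := LinearMap.exists_rightInverse_of_surjective _ hT
  have hP' : ∀ u, A (P u) + M (π (P u)) = u := fun u => by
    simpa using LinearMap.congr_fun hP u
  obtain ⟨α, hα, hX⟩ := exists_ne_zero_forall_add_smul_eq_zero
    (M ∘ₗ (LinearMap.id - π) ∘ₗ P)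
  refine ⟨α, fun u => ?_⟩
  have hinj : Function.Injective
      (LinearMap.id + α • (M ∘ₗ (LinearMap.id - π) ∘ₗ P) : U →ₗ[K] U) :=
    LinearMap.ker_eq_bot.1 (LinearMap.ker_eq_bot'.2 hX)
  obtain ⟨y, rfl⟩ := LinearMap.injective_iff_surjective.1 hinj u
  refine ⟨(P y - π (P y)) + α⁻¹ • π (P y), ?_⟩
  simp only [LinearMap.add_apply, LinearMap.smul_apply, LinearMap.comp_apply,
    LinearMap.sub_apply, LinearMap.id_apply, map_add, map_sub, map_smul, hπ0]
  linear_combination (norm := module) hP' y + smul_inv_smul₀ hα (M (π (P y)))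

end Pencil

section Transfer

variable {σ S K K₁ : Type*} [CommRing S] [Field K] [Field K₁]

/-- The ideal generated by the specialization of a set of forms. -/
noncomputable def specIdeal (Φ : S →+* K) (G : Set (MvPolynomial σ S)) : Ideal (MvPolynomial σ K) :=
  Ideal.span (map Φ '' G)

/-- The monomial multiples of degree `t` of a set of forms. -/
def multiples (G : Set (MvPolynomial σ S)) (t : ℕ) : Set (MvPolynomial σ S) :=
  {q | q.IsHomogeneous t ∧ ∃ m, ∃ g ∈ G, q = monomial m 1 * g}

theorem isHomIdeal_specIdeal (Φ : S →+* K) {G : Set (MvPolynomial σ S)}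
    (hG : ∀ g ∈ G, ∃ d, g.IsHomogeneous d) : IsHomIdeal (specIdeal Φ G) := by
  refine isHomIdeal_span ?_
  rintro _ ⟨g, hg, rfl⟩
  obtain ⟨d, hd⟩ := hG g hg
  exact ⟨d, hd.map Φ⟩

theorem specIdeal_insert (Φ : S →+* K) (g : MvPolynomial σ S) (G : Set (MvPolynomial σ S)) :
    specIdeal Φ (insert g G) = specIdeal Φ G ⊔ Ideal.span {map Φ g} := by
  rw [specIdeal, Set.image_insert_eq, Ideal.span_insert, sup_comm, specIdeal]

theorem idealPart_specIdeal (Φ : S →+* K) {G : Set (MvPolynomial σ S)}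
    (hG : ∀ g ∈ G, ∃ d, g.IsHomogeneous d) (t : ℕ) :
    idealPart (specIdeal Φ G) t = Submodule.span K (map Φ '' multiples G t) := by
  apply le_antisymm
  · have hX : ∀ s (j : σ), ∀ q ∈ Submodule.span K (map Φ '' multiples G s),
        q * X j ∈ Submodule.span K (map Φ '' multiples G (s + 1)) := by
      intro s j q hq
      induction hq using Submodule.span_induction with
      | mem q hq =>
        obtain ⟨_, ⟨hs, m, g, hg, rfl⟩, rfl⟩ := hq
        refine Submodule.subset_span ⟨monomial m 1 * g * X j,
          ⟨hs.mul (isHomogeneous_X S j), m + Finsupp.single j 1, g, hg, ?_⟩, by simp⟩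
        rw [mul_right_comm, X, monomial_mul, mul_one]
      | zero => simp
      | add x y _ _ hx hy => rw [add_mul]; exact add_mem hx hy
      | smul a x _ hx => rw [smul_mul_assoc]; exact Submodule.smul_mem _ _ hx
    have key : ∀ p ∈ specIdeal Φ G, ∀ t,
        homogeneousComponent t p ∈ Submodule.span K (map Φ '' multiples G t) := by
      intro p hp
      induction hp using Submodule.span_induction with
      | mem p hp =>
        obtain ⟨g, hg, rfl⟩ := hp
        obtain ⟨d, hd⟩ := hG g hg
        intro t
        rw [homogeneousComponent_of_mem (hd.map Φ)]
        split_ifs with h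
        · subst h
          exact Submodule.subset_span ⟨g, ⟨hd, 0, g, hg, by simp⟩, rfl⟩
        · exact zero_mem _
      | zero => simp
      | add x y _ _ hx hy => intro t; rw [map_add]; exact add_mem (hx t) (hy t)
      | smul a x _ hx =>
        rw [smul_eq_mul]
        induction a using MvPolynomial.induction_on with
        | C c =>
          intro t
          rw [homogeneousComponent_C_mul, C_mul']
          exact Submodule.smul_mem _ _ (hx t)
        | add p q hp hq => intro t; rw [add_mul, map_add]; exact add_mem (hp t) (hq t)
        | mul_X p j hp =>
          intro t
          rw [mul_right_comm]
          rcases t with _ | t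
          · rw [homogeneousComponent_mul_of_lt (isHomogeneous_X K j) _ one_pos]
            exact zero_mem _
          · rw [homogeneousComponent_mul_of_isHomogeneous (isHomogeneous_X K j)]
            exact hX _ _ _ (hp t)
    rintro p ⟨hp, hpt⟩
    rw [← homogeneousComponent_eq_self hpt]
    exact key p hp t
  · rw [Submodule.span_le]
    rintro _ ⟨_, ⟨hs, m, g, hg, rfl⟩, rfl⟩
    refine ⟨?_, hs.map Φ⟩
    rw [map_mul]
    exact Ideal.mul_mem_left _ _ (Ideal.subset_span ⟨g, hg, rfl⟩)

theorem hilb_specIdeal_empty (Φ : S →+* K) (t : ℕ) :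
    hilb (specIdeal Φ (∅ : Set (MvPolynomial σ S))) t = 0 := by
  rw [hilb, idealPart_specIdeal Φ (by simp)]
  have : multiples (∅ : Set (MvPolynomial σ S)) t = ∅ := by simp [multiples]
  rw [this, Set.image_empty, Submodule.span_empty, finrank_bot]

variable [Finite σ] {Φ : S →+* K} {Ψ : S →+* K₁} {G : Set (MvPolynomial σ S)}

/-- The Hilbert function of an ideal of forms can only drop under specialization. -/
theorem hilb_specIdeal_le (hΦ : Function.Injective Φ) (hG : ∀ g ∈ G, ∃ d, g.IsHomogeneous d)
    (t : ℕ) : hilb (specIdeal Ψ G) t ≤ hilb (specIdeal Φ G) t := by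
  have hfin := finiteDimensional_idealPart (specIdeal Φ G) t
  have hfin' := finiteDimensional_idealPart (specIdeal Ψ G) t
  rw [hilb, hilb, idealPart_specIdeal Φ hG, idealPart_specIdeal Ψ hG]
  rw [idealPart_specIdeal Φ hG] at hfin
  rw [idealPart_specIdeal Ψ hG] at hfin'
  obtain ⟨v, hv, -, hli⟩ :=
    Submodule.exists_fun_fin_finrank_span_eq K₁ (map Ψ '' multiples G t)
  choose p hp hpv using hv
  obtain rfl : (fun i => map Ψ (p i)) = v := funext hpv
  have h2 := linearIndependent_map_of_linearIndependent_map hΦ p hli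
  have h3 : LinearIndependent K fun i =>
      (⟨map Φ (p i), Submodule.subset_span ⟨p i, hp i, rfl⟩⟩ :
        Submodule.span K (map Φ '' multiples G t)) :=
    LinearIndependent.of_comp (Submodule.subtype _) h2
  simpa using h3.fintype_card_le_finrank

theorem hilb_eq_finrank_iff {k : Type*} [Field k] {I : Ideal (MvPolynomial σ k)} {t : ℕ} :
    Module.finrank k (homogeneousSubmodule σ k t) ≤ hilb I t ↔
      ∀ p : MvPolynomial σ k, p.IsHomogeneous t → p ∈ I := by
  constructor
  · intro h p hp
    have : idealPart I t = homogeneousSubmodule σ k t :=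
      Submodule.eq_of_le_of_finrank_le inf_le_right h
    have hp' : p ∈ homogeneousSubmodule σ k t := hp
    rw [← this] at hp'
    exact hp'.1
  · intro h
    have : idealPart I t = homogeneousSubmodule σ k t :=
      inf_eq_right.2 fun p hp => h p hp
    rw [hilb, this]

theorem forall_mem_specIdeal_of_specialization (hΦ : Function.Injective Φ)
    (hG : ∀ g ∈ G, ∃ d, g.IsHomogeneous d) {t : ℕ}
    (h : ∀ p : MvPolynomial σ K₁, p.IsHomogeneous t → p ∈ specIdeal Ψ G) :
    ∀ p : MvPolynomial σ K, p.IsHomogeneous t → p ∈ specIdeal Φ G := by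
  rw [← hilb_eq_finrank_iff] at h ⊢
  rw [finrank_homogeneousSubmodule] at h ⊢
  exact h.trans (hilb_specIdeal_le hΦ hG t)

/-- Injectivity of multiplication by a form passes from a specialization with the same Hilbert
function. -/
theorem injective_of_specialization (hΦ : Function.Injective Φ)
    (hG : ∀ g ∈ G, ∃ d, g.IsHomogeneous d) {g : MvPolynomial σ S} {d : ℕ}
    (hg : g.IsHomogeneous d) {i : ℕ}
    (h1 : hilb (specIdeal Φ G) i = hilb (specIdeal Ψ G) i)
    (h2 : hilb (specIdeal Φ G) (i + d) = hilb (specIdeal Ψ G) (i + d))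
    (hinj : ∀ p : MvPolynomial σ K₁, p.IsHomogeneous i → map Ψ g * p ∈ specIdeal Ψ G →
      p ∈ specIdeal Ψ G) :
    (∀ p : MvPolynomial σ K, p.IsHomogeneous i → map Φ g * p ∈ specIdeal Φ G →
      p ∈ specIdeal Φ G) ∧
    hilb (specIdeal Φ (insert g G)) (i + d) = hilb (specIdeal Ψ (insert g G)) (i + d) := by
  have e1 := hilb_sup_span_singleton (isHomIdeal_specIdeal Φ hG) (hg.map Φ) i
  have e2 := hilb_sup_span_singleton (isHomIdeal_specIdeal Ψ hG) (hg.map Ψ) i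
  rw [finrank_homogeneousSubmodule, ← specIdeal_insert] at e1 e2
  have e3 := hilb_specIdeal_le (Ψ := Ψ) hΦ (G := insert g G) (by
    rintro x (rfl | hx)
    exacts [⟨d, hg⟩, hG x hx]) (i + d)
  have e4 : colonPart (specIdeal Ψ G) (map Ψ g) i = idealPart (specIdeal Ψ G) i :=
    le_antisymm (fun p hp => ⟨hinj p hp.1 hp.2, hp.1⟩) (idealPart_le_colonPart _ _ _)
  have e5 := Submodule.finrank_mono (idealPart_le_colonPart (specIdeal Φ G) (map Φ g) i)
  rw [e4] at e2
  change _ + hilb (specIdeal Ψ G) i = _ at e2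
  change hilb (specIdeal Φ G) i ≤ _ at e5
  refine ⟨fun p hp hpg => ?_, by omega⟩
  have e6 : idealPart (specIdeal Φ G) i = colonPart (specIdeal Φ G) (map Φ g) i :=
    Submodule.eq_of_le_of_finrank_le (idealPart_le_colonPart _ _ _) (by
      change _ ≤ hilb (specIdeal Φ G) i
      omega)
  have hp' : p ∈ colonPart (specIdeal Φ G) (map Φ g) i := ⟨hp, hpg⟩
  rw [← e6] at hp'
  exact hp'.1

end Transfer

section Regular

variable {σ : Type*}

theorem mem_span_X_pow_of_X_pow_mul_mem {k ι : Type*} [CommRing k] {s : ι → σ} {d : ι → ℕ}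
    {T : Set ι} {j : σ} {e : ℕ} (hj : ∀ i ∈ T, s i ≠ j) {r : MvPolynomial σ k}
    (h : X j ^ e * r ∈ Ideal.span ((fun i => (X (s i) ^ d i : MvPolynomial σ k)) '' T)) :
    r ∈ Ideal.span ((fun i => (X (s i) ^ d i : MvPolynomial σ k)) '' T) := by
  have himg : (fun i => (X (s i) ^ d i : MvPolynomial σ k)) '' T =
      (fun m => monomial m (1 : k)) '' ((fun i => Finsupp.single (s i) (d i)) '' T) := by
    rw [Set.image_image]
    simp only [X_pow_eq_monomial]
  rw [himg, mem_ideal_span_monomial_image] at h ⊢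
  intro m hm
  obtain ⟨_, ⟨i, hi, rfl⟩, hle⟩ := h (Finsupp.single j e + m) (by
    rw [mem_support_iff, X_pow_eq_monomial, coeff_monomial_mul, one_mul]
    exact mem_support_iff.1 hm)
  refine ⟨_, ⟨i, hi, rfl⟩, ?_⟩
  rw [Finsupp.single_le_iff] at hle ⊢
  rwa [Finsupp.add_apply, Finsupp.single_eq_of_ne (hj i hi), zero_add] at hle

theorem mem_span_X_pow_of_isHomogeneous {k : Type*} [CommRing k] [Fintype σ] {d : σ → ℕ} {t : ℕ}
    (ht : ∑ j, d j + 1 ≤ t + Fintype.card σ) {r : MvPolynomial σ k} (hr : r.IsHomogeneous t) :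
    r ∈ Ideal.span (Set.range fun j => (X j ^ d j : MvPolynomial σ k)) := by
  have himg : (Set.range fun j => (X j ^ d j : MvPolynomial σ k)) =
      (fun m => monomial m (1 : k)) '' (Set.range fun j => Finsupp.single j (d j)) := by
    rw [← Set.range_comp]
    simp only [X_pow_eq_monomial, Function.comp_def]
  rw [himg, mem_ideal_span_monomial_image]
  intro m hm
  by_contra! hcon
  have h1 : ∀ j, m j + 1 ≤ d j := fun j => by
    have := hcon _ ⟨j, rfl⟩
    rw [Finsupp.single_le_iff] at this
    omega
  have h2 : m.degree = t := by
    rw [Finsupp.degree_eq_weight_one]; exact hr (mem_support_iff.1 hm)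
  have h3 := Finset.sum_le_sum fun j (_ : j ∈ Finset.univ) => h1 j
  rw [Finset.sum_add_distrib, Finset.sum_const, Finset.card_univ, smul_eq_mul, mul_one,
    ← Finsupp.degree_eq_sum, h2] at h3
  omega

variable {S K F ι : Type*} [CommRing S] [Field K] [Field F] [Finite σ]
  {Φ : S →+* K} {Ψ : S →+* F}

/-- Forms specializing to powers of distinct variables form a regular sequence. -/
theorem regular_of_specialization (hΦ : Function.Injective Φ) {p : ι → MvPolynomial σ S}
    {d : ι → ℕ} {s : ι → σ} (hs : Function.Injective s) (hp : ∀ i, (p i).IsHomogeneous (d i))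
    (hΨ : ∀ i, map Ψ (p i) = X (s i) ^ d i) (T : Finset ι) :
    (∀ t, hilb (specIdeal Φ (p '' T)) t = hilb (specIdeal Ψ (p '' T)) t) ∧
    ∀ (q : MvPolynomial σ S) (j : σ) (e : ℕ), q.IsHomogeneous e → map Ψ q = X j ^ e →
      (∀ i ∈ T, s i ≠ j) → ∀ r, map Φ q * r ∈ specIdeal Φ (p '' T) →
        r ∈ specIdeal Φ (p '' T) := by
  classical
  have hG : ∀ T : Finset ι, ∀ g ∈ p '' (T : Set ι), ∃ d, g.IsHomogeneous d := by
    rintro T _ ⟨i, -, rfl⟩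
    exact ⟨_, hp i⟩
  have hΨT : ∀ T : Finset ι, specIdeal Ψ (p '' (T : Set ι)) =
      Ideal.span ((fun i => (X (s i) ^ d i : MvPolynomial σ F)) '' T) := by
    intro T
    rw [specIdeal, Set.image_image]
    simp only [hΨ]
  have main : ∀ T : Finset ι,
      (∀ t, hilb (specIdeal Φ (p '' T)) t = hilb (specIdeal Ψ (p '' T)) t) →
      ∀ (q : MvPolynomial σ S) (j : σ) (e : ℕ), q.IsHomogeneous e → map Ψ q = X j ^ e →
      (∀ i ∈ T, s i ≠ j) → ∀ i,
      (∀ r : MvPolynomial σ K, r.IsHomogeneous i → map Φ q * r ∈ specIdeal Φ (p '' T) →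
        r ∈ specIdeal Φ (p '' T)) ∧
      hilb (specIdeal Φ (insert q (p '' T))) (i + e) =
        hilb (specIdeal Ψ (insert q (p '' T))) (i + e) := by
    intro T hT q j e hq hqΨ hj i
    refine injective_of_specialization hΦ (hG T) hq (hT _) (hT _) fun r _ hr => ?_
    rw [hqΨ, hΨT] at hr
    rw [hΨT]
    exact mem_span_X_pow_of_X_pow_mul_mem (T := (T : Set ι)) (by simpa using hj) hr
  have hhilb : ∀ t, hilb (specIdeal Φ (p '' T)) t = hilb (specIdeal Ψ (p '' T)) t := by
    induction T using Finset.induction_on with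
    | empty =>
      intro t
      rw [Finset.coe_empty, Set.image_empty, hilb_specIdeal_empty, hilb_specIdeal_empty]
    | insert a T ha ih =>
      intro t
      rw [Finset.coe_insert, Set.image_insert_eq]
      rcases lt_or_ge t (d a) with h | h
      · rw [specIdeal_insert, specIdeal_insert,
          hilb_sup_span_singleton_of_lt (isHomIdeal_specIdeal Φ (hG T)) ((hp a).map Φ) h,
          hilb_sup_span_singleton_of_lt (isHomIdeal_specIdeal Ψ (hG T)) ((hp a).map Ψ) h, ih]
      · have := (main T ih (p a) (s a) (d a) (hp a) (hΨ a) (fun i hi hia => by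
          rw [hs hia] at hi; exact ha hi) (t - d a)).2
        rwa [Nat.sub_add_cancel h] at this
  refine ⟨hhilb, fun q j e hq hqΨ hj => ?_⟩
  exact mem_of_forall_homogeneous (isHomIdeal_specIdeal Φ (hG T)) (hq.map Φ)
    fun i => (main T hhilb q j e hq hqΨ hj i).1

theorem forall_mem_specIdeal_range [Fintype σ] (hΦ : Function.Injective Φ)
    {p : σ → MvPolynomial σ S} {d : σ → ℕ} (hp : ∀ i, (p i).IsHomogeneous (d i))
    (hΨ : ∀ i, map Ψ (p i) = X i ^ d i) {t : ℕ} (ht : ∑ j, d j + 1 ≤ t + Fintype.card σ)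
    (r : MvPolynomial σ K) (hr : r.IsHomogeneous t) : r ∈ specIdeal Φ (Set.range p) := by
  refine forall_mem_specIdeal_of_specialization (Ψ := Ψ) hΦ ?_ ?_ r hr
  · rintro _ ⟨i, rfl⟩
    exact ⟨_, hp i⟩
  · intro q hq
    rw [specIdeal, ← Set.range_comp]
    simp only [Function.comp_def, hΨ]
    exact mem_span_X_pow_of_isHomogeneous ht hq

end Regular

section Projection

variable {k : Type*} [CommRing k] {n : ℕ}

@[simp]
theorem projMap_X_last : projMap k n (X (Fin.last n)) = 0 := by simp [projMap]

@[simp]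
theorem projMap_X_castSucc (j : Fin n) : projMap k n (X j.castSucc) = X j := by simp [projMap]

theorem map_projMap {l : Type*} [CommRing l] (φ : k →+* l) (p : MvPolynomial (Fin (n + 1)) k) :
    map φ (projMap k n p) = projMap l n (map φ p) := by
  induction p using MvPolynomial.induction_on with
  | C c => simp [projMap]
  | add p q hp hq => simp only [map_add, hp, hq]
  | mul_X p j hp =>
    rw [map_mul, map_mul, map_mul, map_mul, hp, map_X]
    refine Fin.lastCases ?_ (fun j => ?_) j <;> simp

theorem isHomogeneous_projMap {p : MvPolynomial (Fin (n + 1)) k} {d : ℕ}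
    (hp : p.IsHomogeneous d) : (projMap k n p).IsHomogeneous d := by
  have := hp.aeval (R := k) (fun i : Fin (n + 1) =>
    (Fin.lastCases 0 (fun j => X j) i : MvPolynomial (Fin n) k)) (n := 1) ?_
  · rwa [one_mul] at this
  · intro i
    refine Fin.lastCases ?_ (fun j => ?_) i
    · simpa using isHomogeneous_zero _ _ _
    · simpa using isHomogeneous_X k j

@[simp]
theorem projMap_rename (p : MvPolynomial (Fin n) k) :
    projMap k n (rename Fin.castSucc p) = p := by
  rw [projMap, aeval_rename]
  convert aeval_X_left_apply p using 2
  ext j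
  simp

theorem sub_rename_projMap_mem (p : MvPolynomial (Fin (n + 1)) k) :
    p - rename Fin.castSucc (projMap k n p) ∈
      Ideal.span {(X (Fin.last n) : MvPolynomial (Fin (n + 1)) k)} := by
  induction p using MvPolynomial.induction_on with
  | C c => simp [projMap]
  | add p q hp hq =>
    have := add_mem hp hq
    simp only [map_add]
    convert this using 1
    ring
  | mul_X p j hp =>
    revert hp
    refine Fin.lastCases ?_ (fun j => ?_) j
    · intro _
      simpa using Ideal.mul_mem_left _ p (Ideal.mem_span_singleton_self _)
    · intro hp
      have := Ideal.mul_mem_right (X j.castSucc) _ hp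
      simp only [map_mul, projMap_X_castSucc, rename_X]
      rwa [sub_mul] at this

theorem ker_projMap : RingHom.ker (projMap k n) = Ideal.span {X (Fin.last n)} := by
  apply le_antisymm
  · intro p hp
    have := sub_rename_projMap_mem p
    rwa [(RingHom.mem_ker).1 hp, map_zero, sub_zero] at this
  · rw [Ideal.span_le, Set.singleton_subset_iff]
    exact projMap_X_last

theorem projMap_surjective : Function.Surjective (projMap k n) :=
  fun p => ⟨_, projMap_rename p⟩

theorem mem_sup_span_X_last_iff {I : Ideal (MvPolynomial (Fin (n + 1)) k)}
    {p : MvPolynomial (Fin (n + 1)) k} :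
    p ∈ I ⊔ Ideal.span {X (Fin.last n)} ↔ projMap k n p ∈ I.map (projMap k n) := by
  rw [← ker_projMap]
  have := Ideal.comap_map_of_surjective' (projMap k n).toRingHom
    (by exact projMap_surjective) I
  change p ∈ I ⊔ RingHom.ker (projMap k n).toRingHom ↔ _
  rw [← this]
  rfl

theorem range_fin_succ_eq_insert {α : Type*} (h : Fin (n + 1) → α) :
    Set.range h = insert (h (Fin.last n)) (Set.range fun j : Fin n => h j.castSucc) := by
  ext x
  simp only [Set.mem_range, Set.mem_insert_iff, Fin.exists_fin_succ', eq_comm (a := x), or_comm]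

end Projection

section LinearForms

variable {F : Type*} [Field F]

/-- The linear forms with indeterminate coefficients. -/
noncomputable def linForm (F : Type*) [Field F] (n a : ℕ) :
    MvPolynomial (Fin n) (MvPolynomial (ℕ × ℕ) F) :=
  ∑ j : Fin n, C (X (a, (j : ℕ))) * X j

/-- Products of linear forms with indeterminate coefficients. -/
noncomputable def prodForm (F : Type*) [Field F] (n : ℕ) (A : Finset ℕ) :
    MvPolynomial (Fin n) (MvPolynomial (ℕ × ℕ) F) :=
  ∏ a ∈ A, linForm F n a

theorem isHomogeneous_linForm (n a : ℕ) : (linForm F n a).IsHomogeneous 1 :=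
  IsHomogeneous.sum _ _ _ fun j _ => by
    simpa using (isHomogeneous_C (Fin n) (X (a, (j : ℕ)) : MvPolynomial (ℕ × ℕ) F)).mul
      (isHomogeneous_X _ j)

theorem isHomogeneous_prodForm (n : ℕ) (A : Finset ℕ) :
    (prodForm F n A).IsHomogeneous A.card := by
  have := IsHomogeneous.prod A (linForm F n) (fun _ => 1) fun a _ => isHomogeneous_linForm n a
  rwa [← Finset.card_eq_sum_ones] at this

theorem prodForm_empty (n : ℕ) : prodForm F n ∅ = 1 := Finset.prod_empty

theorem prodForm_insert (n : ℕ) {a : ℕ} {A : Finset ℕ} (ha : a ∉ A) :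
    prodForm F n (insert a A) = linForm F n a * prodForm F n A := Finset.prod_insert ha

theorem prodForm_union (n : ℕ) {A B : Finset ℕ} (h : Disjoint A B) :
    prodForm F n (A ∪ B) = prodForm F n A * prodForm F n B := Finset.prod_union h

theorem projMap_linForm (n a : ℕ) :
    projMap (MvPolynomial (ℕ × ℕ) F) n (linForm F (n + 1) a) = linForm F n a := by
  rw [linForm, Fin.sum_univ_castSucc, map_add, map_sum, map_mul, projMap_X_last, mul_zero,
    add_zero, linForm]
  refine Finset.sum_congr rfl fun j _ => ?_
  rw [map_mul, projMap_X_castSucc, projMap, algHom_C]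
  rfl

theorem projMap_prodForm (n : ℕ) (A : Finset ℕ) :
    projMap (MvPolynomial (ℕ × ℕ) F) n (prodForm F (n + 1) A) = prodForm F n A := by
  rw [prodForm, map_prod]
  exact Finset.prod_congr rfl fun a _ => projMap_linForm n a

/-- The specialization of the linear forms to variables. -/
noncomputable def selectHom (F : Type*) [Field F] {n : ℕ} (s : ℕ → Fin n) :
    MvPolynomial (ℕ × ℕ) F →+* F :=
  eval fun p => if p.2 = s p.1 then 1 else 0

theorem map_selectHom_linForm {n : ℕ} (s : ℕ → Fin n) (a : ℕ) :
    map (selectHom F s) (linForm F n a) = X (s a) := by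
  rw [linForm, map_sum, Finset.sum_eq_single (s a)]
  · simp [selectHom]
  · intro j _ hj
    have : (j : ℕ) ≠ s a := fun h => hj (Fin.ext h)
    simp [selectHom, this]
  · simp

theorem map_selectHom_prodForm {n : ℕ} (s : ℕ → Fin n) {A : Finset ℕ} {j : Fin n}
    (h : ∀ a ∈ A, s a = j) : map (selectHom F s) (prodForm F n A) = X j ^ A.card := by
  rw [prodForm, map_prod, ← Finset.prod_const]
  exact Finset.prod_congr rfl fun a ha => by rw [map_selectHom_linForm, h a ha]

theorem exists_select {ι : Type*} {N : ℕ} {A : ι → Finset ℕ}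
    (hA : ∀ i j, i ≠ j → Disjoint (A i) (A j)) (s : ι → Fin N) (l : Fin N) :
    ∃ f : ℕ → Fin N, (∀ i, ∀ a ∈ A i, f a = s i) ∧ ∀ a, (∀ i, a ∉ A i) → f a = l := by
  classical
  refine ⟨fun a => if h : ∃ i, a ∈ A i then s h.choose else l, fun i a ha => ?_, fun a ha => ?_⟩
  · have h : ∃ i, a ∈ A i := ⟨i, ha⟩
    refine (dif_pos h).trans ?_
    congr 1
    by_contra hne
    exact Finset.disjoint_left.1 (hA _ _ hne) h.choose_spec ha
  · exact dif_neg (by simpa using ha)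

end LinearForms

section Special

variable {σ K : Type*} [Finite σ] [Field K] [Infinite K]

theorem exists_injective_special {J : Ideal (MvPolynomial σ K)} (hJ : IsHomIdeal J)
    {z l f g : MvPolynomial σ K} {e i : ℕ} (hf : f.IsHomogeneous e)
    (hz : ∀ p, z * p ∈ J → p ∈ J)
    (h1 : ∀ a : MvPolynomial σ K, a.IsHomogeneous i → g * a ∈ J ⊔ Ideal.span {f} →
      a ∈ J ⊔ Ideal.span {f})
    (h2 : e ≤ i → ∀ b : MvPolynomial σ K, b.IsHomogeneous (i - e) →
      f * (l * g) * b ∈ J ⊔ Ideal.span {z} → b ∈ J ⊔ Ideal.span {z}) :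
    ∃ α : K, ∀ p : MvPolynomial σ K, p.IsHomogeneous i →
      ((z + C α * l) * g) * p ∈ J ⊔ Ideal.span {z * f} → p ∈ J ⊔ Ideal.span {z * f} := by
  set J₀ := J ⊔ Ideal.span {z * f} with hJ₀
  let V : Submodule K (MvPolynomial σ K ⧸ J₀) :=
    (homogeneousSubmodule σ K i).map (Ideal.Quotient.mkₐ K J₀).toLinearMap
  let A : V →ₗ[K] (MvPolynomial σ K ⧸ J₀) :=
    (LinearMap.mulLeft K (Ideal.Quotient.mk J₀ (z * g))).domRestrict V
  let M : V →ₗ[K] (MvPolynomial σ K ⧸ J₀) :=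
    (LinearMap.mulLeft K (Ideal.Quotient.mk J₀ (l * g))).domRestrict V
  have key : ∀ v w : V, A v = 0 → M v = A w → v = 0 := by
    rintro ⟨_, a, ha, rfl⟩ ⟨_, w, _, rfl⟩ hA hM
    have hA' : z * g * a ∈ J₀ := Ideal.Quotient.eq_zero_iff_mem.1 hA
    have hM' : l * g * a - z * g * w ∈ J₀ := (Ideal.Quotient.mk_eq_mk_iff_sub_mem _ _).1 hM
    refine Subtype.ext (Ideal.Quotient.eq_zero_iff_mem.2 ?_)
    have hga : g * a ∈ J ⊔ Ideal.span {f} := by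
      obtain ⟨u, hu, v, hv, huv⟩ := Submodule.mem_sup.1 hA'
      obtain ⟨c, rfl⟩ := Ideal.mem_span_singleton'.1 hv
      have := hz (g * a - c * f) (by
        convert hu using 1
        linear_combination -huv)
      rw [← sub_add_cancel (g * a) (c * f)]
      exact Submodule.add_mem_sup this (Ideal.mem_span_singleton'.2 ⟨c, rfl⟩)
    obtain ⟨b, hb, hb0, hab⟩ := hJ.exists_homogeneous_cofactor hf ha (h1 a ha hga)
    rcases lt_or_ge i e with hie | hie
    · rw [hb0 hie, zero_mul, sub_zero] at hab
      exact Ideal.mem_sup_left hab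
    · have hJz : J₀ ≤ J ⊔ Ideal.span {z} := sup_le_sup_left
        (Ideal.span_singleton_le_span_singleton.2 (dvd_mul_right z f)) J
      have hb' := h2 hie b hb (by
        have e1 := hJz hM'
        have e2 : z * g * w ∈ J ⊔ Ideal.span {z} :=
          Ideal.mem_sup_right (Ideal.mem_span_singleton.2 ⟨g * w, by ring⟩)
        have e3 : l * g * (a - b * f) ∈ J ⊔ Ideal.span {z} :=
          Ideal.mem_sup_left (Ideal.mul_mem_left _ _ hab)
        convert sub_mem (add_mem e1 e2) e3 using 1
        ring)
      obtain ⟨u, hu, v, hv, huv⟩ := Submodule.mem_sup.1 hb'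
      obtain ⟨c, rfl⟩ := Ideal.mem_span_singleton'.1 hv
      have e1 : a - b * f + u * f ∈ J := add_mem hab (Ideal.mul_mem_right _ _ hu)
      have e2 : c * (z * f) ∈ Ideal.span {z * f} := Ideal.mem_span_singleton'.2 ⟨c, rfl⟩
      convert Submodule.add_mem_sup e1 e2 using 1
      rw [← huv]
      ring
  obtain ⟨α, hα⟩ := exists_injective_add_smul A M key
  refine ⟨α, fun p hp hpJ => ?_⟩
  have h0 : (⟨_, p, hp, rfl⟩ : V) = 0 := by
    apply hα
    rw [map_zero]
    refine Eq.trans ?_ (Ideal.Quotient.eq_zero_iff_mem.2 hpJ)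
    change Ideal.Quotient.mk J₀ (z * g) * Ideal.Quotient.mk J₀ p +
      α • (Ideal.Quotient.mk J₀ (l * g) * Ideal.Quotient.mk J₀ p) = _
    rw [← map_mul, ← map_mul]
    change Ideal.Quotient.mk J₀ (z * g * p) + Ideal.Quotient.mk J₀ (α • (l * g * p)) = _
    rw [← map_add, smul_eq_C_mul]
    congr 1
    ring
  exact Ideal.Quotient.eq_zero_iff_mem.1 (congrArg Subtype.val h0)

theorem exists_surjective_special {J : Ideal (MvPolynomial σ K)} (hJ : IsHomIdeal J)
    {z l f g : MvPolynomial σ K} {e d' i : ℕ} (hz : z.IsHomogeneous 1) (hl : l.IsHomogeneous 1)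
    (hf : f.IsHomogeneous e) (hg : g.IsHomogeneous d')
    (h1 : ∀ p : MvPolynomial σ K, p.IsHomogeneous (i + d' + 1) →
      p ∈ J ⊔ Ideal.span {f * (l * g)} ⊔ Ideal.span {z})
    (h2 : ∀ r : MvPolynomial σ K, r.IsHomogeneous (i + d') →
      r ∈ J ⊔ Ideal.span {f} ⊔ Ideal.span {g}) :
    ∃ α : K, ∀ p : MvPolynomial σ K, p.IsHomogeneous (i + d' + 1) →
      p ∈ J ⊔ Ideal.span {z * f} ⊔ Ideal.span {(z + C α * l) * g} := by
  set J₀ := J ⊔ Ideal.span {z * f} with hJ₀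
  let V := homogeneousSubmodule σ K i
  let U : Submodule K (MvPolynomial σ K ⧸ J₀) :=
    (homogeneousSubmodule σ K (i + d' + 1)).map (Ideal.Quotient.mkₐ K J₀).toLinearMap
  have hmul : ∀ m : MvPolynomial σ K, m.IsHomogeneous (d' + 1) → ∀ v : V,
      ((Ideal.Quotient.mkₐ K J₀).toLinearMap ∘ₗ LinearMap.mulLeft K m ∘ₗ V.subtype) v ∈ U := by
    intro m hm v
    refine ⟨m * v, ?_, rfl⟩
    have := hm.mul v.2
    rwa [add_comm, ← add_assoc] at this
  have hzg : (z * g).IsHomogeneous (d' + 1) := by rw [add_comm]; exact hz.mul hg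
  have hlg : (l * g).IsHomogeneous (d' + 1) := by rw [add_comm]; exact hl.mul hg
  let A : V →ₗ[K] U := LinearMap.codRestrict U _ (hmul _ hzg)
  let M : V →ₗ[K] U := LinearMap.codRestrict U _ (hmul _ hlg)
  have key : ∀ u : U, ∃ v w : V, A w = 0 ∧ u = A v + M w := by
    rintro ⟨_, p, hp, rfl⟩
    have hp' : p.IsHomogeneous (i + d' + 1) := hp
    have hflg : (f * (l * g)).IsHomogeneous (e + (d' + 1)) := hf.mul hlg
    obtain ⟨r, hr, -, hpr⟩ := (hJ.sup (isHomIdeal_span_singleton hflg)).exists_homogeneous_cofactor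
      hz hp' (h1 p hp')
    rw [Nat.add_sub_cancel] at hr
    obtain ⟨b, hb, hb0, hpb⟩ := hJ.exists_homogeneous_cofactor hflg
      (hp'.sub (hr.mul hz)) hpr
    obtain ⟨s, hs, -, hrs⟩ := (hJ.sup (isHomIdeal_span_singleton hf)).exists_homogeneous_cofactor
      hg hr (h2 r hr)
    rw [Nat.add_sub_cancel] at hs
    have hw : (f * b).IsHomogeneous i := by
      rcases lt_or_ge (i + d' + 1) (e + (d' + 1)) with h | h
      · rw [hb0 h, mul_zero]
        exact isHomogeneous_zero _ _ _
      · have := hf.mul hb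
        rwa [show e + (i + d' + 1 - (e + (d' + 1))) = i by omega] at this
    refine ⟨⟨s, hs⟩, ⟨f * b, hw⟩, Subtype.ext (Ideal.Quotient.eq_zero_iff_mem.2 ?_),
      Subtype.ext ((Ideal.Quotient.mk_eq_mk_iff_sub_mem _ _).2 ?_)⟩
    · change z * g * (f * b) ∈ J₀
      exact Ideal.mem_sup_right (Ideal.mem_span_singleton.2 ⟨g * b, by ring⟩)
    · change p - (z * g * s + l * g * (f * b)) ∈ J₀
      have e1 : z * (r - s * g) ∈ J₀ := by
        obtain ⟨u, hu, v, hv, huv⟩ := Submodule.mem_sup.1 hrs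
        obtain ⟨c, rfl⟩ := Ideal.mem_span_singleton'.1 hv
        rw [← huv, mul_add]
        exact Submodule.add_mem_sup (Ideal.mul_mem_left _ _ hu)
          (Ideal.mem_span_singleton.2 ⟨c, by ring⟩)
      convert add_mem (Ideal.mem_sup_left hpb) e1 using 1
      ring
  obtain ⟨α, hα⟩ := exists_surjective_add_smul A M key
  refine ⟨α, fun p hp => ?_⟩
  obtain ⟨v, hv⟩ := hα ⟨_, p, hp, rfl⟩
  have hv' : Ideal.Quotient.mk J₀ (z * g * v + α • (l * g * v)) = Ideal.Quotient.mk J₀ p :=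
    congrArg Subtype.val hv
  have hv'' := (Ideal.Quotient.mk_eq_mk_iff_sub_mem _ _).1 hv'
  rw [smul_eq_C_mul] at hv''
  have e1 : ((z + C α * l) * g) * (v : MvPolynomial σ K) ∈ Ideal.span {(z + C α * l) * g} :=
    Ideal.mul_mem_right _ _ (Ideal.mem_span_singleton_self _)
  convert Submodule.add_mem_sup (neg_mem hv'') e1 using 1
  ring

end Special

section Core

variable {F K : Type*} [Field F] [Field K]

theorem hilb_sup_eq_of_nonzerodivisor {σ : Type*} [Finite σ] {I : Ideal (MvPolynomial σ K)}
    (hI : IsHomIdeal I) {u v : MvPolynomial σ K} {d : ℕ} (hu : u.IsHomogeneous d)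
    (hv : v.IsHomogeneous d) (hu' : ∀ p, u * p ∈ I → p ∈ I) (hv' : ∀ p, v * p ∈ I → p ∈ I)
    (t : ℕ) : hilb (I ⊔ Ideal.span {u}) t = hilb (I ⊔ Ideal.span {v}) t := by
  rcases lt_or_ge t d with h | h
  · rw [hilb_sup_span_singleton_of_lt hI hu h, hilb_sup_span_singleton_of_lt hI hv h]
  · obtain ⟨i, rfl⟩ := Nat.exists_eq_add_of_le' h
    have e1 := hilb_sup_span_singleton hI hu i
    have e2 := hilb_sup_span_singleton hI hv i
    have h3 : colonPart I u i = colonPart I v i := by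
      ext p
      exact ⟨fun hp => ⟨hp.1, I.mul_mem_left _ (hu' _ hp.2)⟩,
        fun hp => ⟨hp.1, I.mul_mem_left _ (hv' _ hp.2)⟩⟩
    rw [h3] at e1
    omega

/-- The ideal of products of generic linear forms. -/
noncomputable def prodIdeal (Φ : MvPolynomial (ℕ × ℕ) F →+* K) (N : ℕ) {ι : Type*}
    (A : ι → Finset ℕ) : Ideal (MvPolynomial (Fin N) K) :=
  specIdeal Φ (Set.range fun k => prodForm F N (A k))

theorem isHomogeneous_of_mem_range_prodForm {N : ℕ} {ι : Type*} (A : ι → Finset ℕ) :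
    ∀ g ∈ Set.range fun k => prodForm F N (A k), ∃ d, g.IsHomogeneous d := by
  rintro _ ⟨k, rfl⟩
  exact ⟨_, isHomogeneous_prodForm _ _⟩

theorem prodIdeal_snoc (Φ : MvPolynomial (ℕ × ℕ) F →+* K) (N : ℕ) {n : ℕ}
    (A : Fin n → Finset ℕ) (C : Finset ℕ) :
    prodIdeal Φ N (Fin.snoc A C : Fin (n + 1) → Finset ℕ) =
      prodIdeal Φ N A ⊔ Ideal.span {map Φ (prodForm F N C)} := by
  rw [prodIdeal, range_fin_succ_eq_insert, specIdeal_insert]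
  simp only [Fin.snoc_last, Fin.snoc_castSucc]
  rfl

theorem mem_prodIdeal_sup_iff (Φ : MvPolynomial (ℕ × ℕ) F →+* K) {N : ℕ} {ι : Type*}
    (A : ι → Finset ℕ) (p : MvPolynomial (Fin (N + 1)) K) :
    p ∈ prodIdeal Φ (N + 1) A ⊔ Ideal.span {X (Fin.last N)} ↔
      projMap K N p ∈ prodIdeal Φ N A := by
  rw [mem_sup_span_X_last_iff, prodIdeal, specIdeal, Ideal.map_span, prodIdeal, specIdeal]
  have : (projMap K N '' (map Φ '' Set.range fun k => prodForm F (N + 1) (A k))) =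
      map Φ '' Set.range fun k => prodForm F N (A k) := by
    rw [← Set.range_comp, ← Set.range_comp, ← Set.range_comp]
    congr 1
    funext k
    simp only [Function.comp_apply]
    rw [← map_projMap, projMap_prodForm]
  rw [this]

/-- The injectivity half of the maximal rank statement for products of linear forms. -/
def ProdInj (Φ : MvPolynomial (ℕ × ℕ) F →+* K) {n : ℕ} (A : Fin n → Finset ℕ)
    (B : Finset ℕ) : Prop :=
  ∀ i, ∀ p : MvPolynomial (Fin n) K, p.IsHomogeneous i → 2 * i + B.card + n ≤ ∑ k, (A k).card →
    map Φ (prodForm F n B) * p ∈ prodIdeal Φ n A → p ∈ prodIdeal Φ n A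

/-- The surjectivity half of the maximal rank statement for products of linear forms. -/
def ProdVan (Φ : MvPolynomial (ℕ × ℕ) F →+* K) {n : ℕ} (A : Fin n → Finset ℕ)
    (B : Finset ℕ) : Prop :=
  ∀ t, ∀ p : MvPolynomial (Fin n) K, p.IsHomogeneous t → ∑ k, (A k).card + B.card ≤ 2 * t + n →
    p ∈ prodIdeal Φ n A ⊔ Ideal.span {map Φ (prodForm F n B)}

variable {Φ : MvPolynomial (ℕ × ℕ) F →+* K}

theorem nonzerodivisor_of_select (hΦ : Function.Injective Φ) {n : ℕ} {A : Fin n → Finset ℕ}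
    (hA : ∀ i j, i ≠ j → Disjoint (A i) (A j))
    {q : MvPolynomial (Fin (n + 1)) (MvPolynomial (ℕ × ℕ) F)} {e : ℕ} (hq : q.IsHomogeneous e)
    (hq' : ∀ f : ℕ → Fin (n + 1), (∀ a, (∀ i, a ∉ A i) → f a = Fin.last n) →
      map (selectHom F f) q = X (Fin.last n) ^ e) (r : MvPolynomial (Fin (n + 1)) K)
    (hr : map Φ q * r ∈ prodIdeal Φ (n + 1) A) : r ∈ prodIdeal Φ (n + 1) A := by
  obtain ⟨f, hf1, hf2⟩ := exists_select hA Fin.castSucc (Fin.last n)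
  have := (regular_of_specialization (Ψ := selectHom F f) hΦ (Fin.castSucc_injective n)
    (p := fun k => prodForm F (n + 1) (A k)) (fun k => isHomogeneous_prodForm _ _)
    (fun k => map_selectHom_prodForm f (hf1 k)) Finset.univ).2 q (Fin.last n) e hq (hq' f hf2)
    (fun i _ => (Fin.castSucc_lt_last i).ne) r
  rw [Finset.coe_univ, Set.image_univ] at this
  exact this hr

/-- The specialization moving two of the linear forms into a pencil through the last variable. -/
noncomputable def pencilHom (Φ : MvPolynomial (ℕ × ℕ) F →+* K) (n a₀ b₀ : ℕ) (α : K) :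
    MvPolynomial (ℕ × ℕ) F →+* K :=
  eval₂Hom (Φ.comp C) fun p => if p.1 = a₀ then (if p.2 = n then 1 else 0) else
    if p.1 = b₀ then (if p.2 = n then 1 else 0) + α * Φ (X p) else Φ (X p)

theorem map_pencilHom_linForm_of_ne {n a₀ b₀ a : ℕ} {α : K} (h₁ : a ≠ a₀) (h₂ : a ≠ b₀) :
    map (pencilHom Φ n a₀ b₀ α) (linForm F (n + 1) a) = map Φ (linForm F (n + 1) a) := by
  simp [linForm, pencilHom, h₁, h₂]

theorem map_pencilHom_linForm_left {n a₀ b₀ : ℕ} {α : K} :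
    map (pencilHom Φ n a₀ b₀ α) (linForm F (n + 1) a₀) = X (Fin.last n) := by
  rw [linForm, Fin.sum_univ_castSucc, map_add, map_sum, Finset.sum_eq_zero]
  · simp [pencilHom]
  · intro j _
    simp [pencilHom, j.isLt.ne]

theorem map_pencilHom_linForm_right {n a₀ b₀ : ℕ} {α : K} (h : b₀ ≠ a₀) :
    map (pencilHom Φ n a₀ b₀ α) (linForm F (n + 1) b₀) =
      X (Fin.last n) + C α * map Φ (linForm F (n + 1) b₀) := by
  have h1 : ∀ j : Fin n, pencilHom Φ n a₀ b₀ α (X (b₀, (j : ℕ))) = α * Φ (X (b₀, (j : ℕ))) :=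
    fun j => by simp [pencilHom, h, j.isLt.ne]
  have h2 : pencilHom Φ n a₀ b₀ α (X (b₀, n)) = 1 + α * Φ (X (b₀, n)) := by
    simp [pencilHom, h]
  rw [linForm, Fin.sum_univ_castSucc]
  simp only [map_add, map_sum, map_mul, map_C, map_X, Fin.val_castSucc, Fin.val_last, h1, h2,
    C_1, mul_add, Finset.mul_sum]
  simp only [add_mul, one_mul, mul_assoc]
  ring

theorem map_pencilHom_prodForm {n a₀ b₀ : ℕ} {α : K} {A : Finset ℕ} (h₁ : a₀ ∉ A) (h₂ : b₀ ∉ A) :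
    map (pencilHom Φ n a₀ b₀ α) (prodForm F (n + 1) A) = map Φ (prodForm F (n + 1) A) := by
  rw [prodForm, map_prod, map_prod]
  refine Finset.prod_congr rfl fun a ha => map_pencilHom_linForm_of_ne ?_ ?_
  · rintro rfl; exact h₁ ha
  · rintro rfl; exact h₂ ha

variable [Infinite K]

theorem prod_step (hΦ : Function.Injective Φ) {n : ℕ} {A : Fin n → Finset ℕ} {B C : Finset ℕ}
    {a₀ b₀ : ℕ} (hA : ∀ i j, i ≠ j → Disjoint (A i) (A j))
    (hAC : ∀ k, Disjoint (A k) (insert a₀ C)) (hAB : ∀ k, Disjoint (A k) (insert b₀ B))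
    (hCB : Disjoint (insert a₀ C) (insert b₀ B)) (ha₀ : a₀ ∉ C) (hb₀ : b₀ ∉ B)
    (ihn : ProdInj Φ A (C ∪ insert b₀ B) ∧ ProdVan Φ A (C ∪ insert b₀ B))
    (ihC : ProdInj Φ (Fin.snoc A C : Fin (n + 1) → Finset ℕ) B ∧
      ProdVan Φ (Fin.snoc A C : Fin (n + 1) → Finset ℕ) B) :
    ProdInj Φ (Fin.snoc A (insert a₀ C) : Fin (n + 1) → Finset ℕ) (insert b₀ B) ∧
      ProdVan Φ (Fin.snoc A (insert a₀ C) : Fin (n + 1) → Finset ℕ) (insert b₀ B) := by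
  have hab : b₀ ≠ a₀ := by
    rintro rfl
    exact Finset.disjoint_left.1 hCB (Finset.mem_insert_self _ _) (Finset.mem_insert_self _ _)
  have ha₀A : ∀ k, a₀ ∉ A k := fun k h =>
    Finset.disjoint_left.1 (hAC k) h (Finset.mem_insert_self _ _)
  have hb₀A : ∀ k, b₀ ∉ A k := fun k h =>
    Finset.disjoint_left.1 (hAB k) h (Finset.mem_insert_self _ _)
  have ha₀B : a₀ ∉ B := fun h => Finset.disjoint_left.1 hCB (Finset.mem_insert_self _ _)
    (Finset.mem_insert_of_mem h)
  have hb₀C : b₀ ∉ C := fun h => Finset.disjoint_left.1 hCB (Finset.mem_insert_of_mem h)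
    (Finset.mem_insert_self _ _)
  have hCB' : Disjoint C (insert b₀ B) := hCB.mono_left (Finset.subset_insert _ _)
  have hcardC : (insert a₀ C).card = C.card + 1 := Finset.card_insert_of_notMem ha₀
  have hcardB : (insert b₀ B).card = B.card + 1 := Finset.card_insert_of_notMem hb₀
  have hcardU : (C ∪ insert b₀ B).card = C.card + B.card + 1 := by
    rw [Finset.card_union_of_disjoint hCB', hcardB, add_assoc]
  set J : Ideal (MvPolynomial (Fin (n + 1)) K) := prodIdeal Φ (n + 1) A with hJdef
  set z : MvPolynomial (Fin (n + 1)) K := X (Fin.last n) with hzdef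
  set f := map Φ (prodForm F (n + 1) C) with hfdef
  set g := map Φ (prodForm F (n + 1) B) with hgdef
  set l := map Φ (linForm F (n + 1) b₀) with hldef
  have hJ : IsHomIdeal J := isHomIdeal_specIdeal Φ (isHomogeneous_of_mem_range_prodForm A)
  have hzh : z.IsHomogeneous 1 := isHomogeneous_X K _
  have hfh : f.IsHomogeneous C.card := (isHomogeneous_prodForm _ _).map Φ
  have hgh : g.IsHomogeneous B.card := (isHomogeneous_prodForm _ _).map Φ
  have hlh : l.IsHomogeneous 1 := (isHomogeneous_linForm _ _).map Φ
  have hz : ∀ p, z * p ∈ J → p ∈ J := fun p hp =>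
    nonzerodivisor_of_select hΦ hA (q := X (Fin.last n)) (isHomogeneous_X _ _)
      (fun f _ => by simp) p (by simpa using hp)
  have hprod : ∀ D : Finset ℕ, (∀ k, Disjoint (A k) D) →
      ∀ p, map Φ (prodForm F (n + 1) D) * p ∈ J → p ∈ J := fun D hD p hp =>
    nonzerodivisor_of_select hΦ hA (isHomogeneous_prodForm (n + 1) D)
      (fun f hf => map_selectHom_prodForm f fun a ha =>
        hf a fun i hi => Finset.disjoint_left.1 (hD i) hi ha) p hp
  have hf : ∀ p, f * p ∈ J → p ∈ J := hprod C fun k =>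
    (hAC k).mono_right (Finset.subset_insert _ _)
  have hG : Set.range (fun k => prodForm F (n + 1)
      ((Fin.snoc A (insert a₀ C) : Fin (n + 1) → Finset ℕ) k)) =
      insert (prodForm F (n + 1) (insert a₀ C)) (Set.range fun k => prodForm F (n + 1) (A k)) := by
    rw [range_fin_succ_eq_insert]
    simp only [Fin.snoc_last, Fin.snoc_castSucc]
  have hJα : ∀ α, specIdeal (pencilHom Φ n a₀ b₀ α) (Set.range fun k => prodForm F (n + 1)
      ((Fin.snoc A (insert a₀ C) : Fin (n + 1) → Finset ℕ) k)) = J ⊔ Ideal.span {z * f} := by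
    intro α
    rw [hG, specIdeal_insert, prodForm_insert _ ha₀, map_mul, map_pencilHom_linForm_left,
      map_pencilHom_prodForm ha₀ hb₀C, specIdeal, hJdef, prodIdeal, specIdeal]
    congr 2
    rw [← Set.range_comp, ← Set.range_comp]
    congr 1
    funext k
    exact map_pencilHom_prodForm (ha₀A k) (hb₀A k)
  have hgα : ∀ α, map (pencilHom Φ n a₀ b₀ α) (prodForm F (n + 1) (insert b₀ B)) =
      (z + MvPolynomial.C α * l) * g := by
    intro α
    rw [prodForm_insert _ hb₀, map_mul, map_pencilHom_linForm_right hab,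
      map_pencilHom_prodForm ha₀B hb₀]
  have hproj : projMap K n (f * (l * g)) = map Φ (prodForm F n (C ∪ insert b₀ B)) := by
    rw [hfdef, hldef, hgdef, ← map_mul, ← map_mul, ← map_projMap]
    congr 1
    rw [map_mul, map_mul, projMap_prodForm, projMap_prodForm, projMap_linForm,
      prodForm_union _ hCB', prodForm_insert _ hb₀]
  have hsum : ∀ D : Finset ℕ, ∑ k, ((Fin.snoc A D : Fin (n + 1) → Finset ℕ) k).card =
      ∑ k, (A k).card + D.card := by
    intro D
    rw [Fin.sum_univ_castSucc]
    simp only [Fin.snoc_last, Fin.snoc_castSucc]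
  constructor
  · intro i p hp hi hpJ
    rw [hsum, hcardC, hcardB] at hi
    obtain ⟨α, hα⟩ := exists_injective_special hJ (z := z) (l := l) (g := g) (i := i) hfh hz
      (fun a ha haJ => by
        rw [hfdef, hJdef, ← prodIdeal_snoc] at haJ ⊢
        exact ihC.1 i a ha (by rw [hsum]; omega) haJ)
      (fun hei b hb hbJ => by
        rw [hJdef, hzdef, mem_prodIdeal_sup_iff] at hbJ ⊢
        rw [map_mul, hproj] at hbJ
        exact ihn.1 _ _ (isHomogeneous_projMap hb) (by rw [hcardU]; omega) hbJ)
    refine (injective_of_specialization (Ψ := pencilHom Φ n a₀ b₀ α) hΦ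
      (isHomogeneous_of_mem_range_prodForm _) (isHomogeneous_prodForm _ _) (i := i) ?_ ?_ ?_).1
      p hp hpJ
    iterate 2
      rw [hJα]
      change hilb (prodIdeal Φ (n + 1) _) _ = _
      rw [prodIdeal_snoc]
      exact hilb_sup_eq_of_nonzerodivisor hJ ((isHomogeneous_prodForm _ _).map Φ)
        (by rw [hcardC, add_comm C.card 1]; exact hzh.mul hfh) (hprod _ hAC)
        (fun p hp => hf _ (hz _ (by rwa [← mul_assoc]))) _
    · intro q hq hqJ
      rw [hJα, hgα] at *
      exact hα q hq hqJ
  · intro t p hp ht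
    rw [hsum, hcardC, hcardB] at ht
    rcases lt_or_ge t (B.card + 1) with htB | htB
    · refine Ideal.mem_sup_left ?_
      obtain ⟨s, hs, -⟩ := exists_select (A := (Fin.snoc A (insert a₀ C) : Fin (n + 1) → Finset ℕ))
        (by
          intro i j hij
          revert hij
          refine Fin.lastCases ?_ (fun i => ?_) i <;> refine Fin.lastCases ?_ (fun j => ?_) j
          · simp
          · intro _; simpa using (hAC j).symm
          · intro _; simpa using hAC i
          · intro h; simpa using hA i j (fun h' => h (by rw [h']))) id (Fin.last n)
      refine forall_mem_specIdeal_range (Ψ := selectHom F s) hΦ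
        (fun k => isHomogeneous_prodForm _ _) (fun k => map_selectHom_prodForm s (hs k))
        (t := t) ?_ p hp
      rw [hsum, hcardC, Fintype.card_fin]
      omega
    · obtain ⟨i, rfl⟩ : ∃ i, t = i + B.card + 1 := ⟨t - (B.card + 1), by omega⟩
      obtain ⟨α, hα⟩ := exists_surjective_special hJ (i := i) hzh hlh hfh hgh
        (fun q hq => by
          rw [sup_assoc, sup_comm (Ideal.span _), ← sup_assoc]
          have h1 := ihn.2 _ _ (isHomogeneous_projMap hq) (by rw [hcardU]; omega)
          rw [← hproj] at h1
          obtain ⟨u, hu, v, hv, huv⟩ := Submodule.mem_sup.1 h1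
          obtain ⟨c, rfl⟩ := Ideal.mem_span_singleton'.1 hv
          have h2 : q - rename Fin.castSucc c * (f * (l * g)) ∈ J ⊔ Ideal.span {z} := by
            rw [hJdef, hzdef, mem_prodIdeal_sup_iff, map_sub, map_mul, projMap_rename, ← huv,
              add_sub_cancel_right]
            exact hu
          rw [← sub_add_cancel q (rename Fin.castSucc c * (f * (l * g)))]
          exact Submodule.add_mem_sup h2 (Ideal.mem_span_singleton'.2 ⟨_, rfl⟩))
        (fun r hr => by
          rw [hfdef, hJdef, ← prodIdeal_snoc]
          exact ihC.2 _ r hr (by rw [hsum]; omega))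
      have key := forall_mem_specIdeal_of_specialization (Φ := Φ)
        (Ψ := pencilHom Φ n a₀ b₀ α) hΦ (t := i + B.card + 1)
        (G := insert (prodForm F (n + 1) (insert b₀ B)) (Set.range fun k => prodForm F (n + 1)
          ((Fin.snoc A (insert a₀ C) : Fin (n + 1) → Finset ℕ) k))) (by
          rintro x (rfl | hx)
          · exact ⟨_, isHomogeneous_prodForm _ _⟩
          · exact isHomogeneous_of_mem_range_prodForm _ x hx) (by
          intro q hq
          rw [specIdeal_insert, hJα, hgα]
          exact hα q hq) p hp
      rwa [specIdeal_insert] at key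

/-- Maximal rank for products of generic linear forms. -/
theorem prodInj_and_prodVan (hΦ : Function.Injective Φ) {n : ℕ} (A : Fin n → Finset ℕ)
    (B : Finset ℕ) (hA : ∀ i j, i ≠ j → Disjoint (A i) (A j)) (hAB : ∀ k, Disjoint (A k) B) :
    ProdInj Φ A B ∧ ProdVan Φ A B := by
  have hempty : ∀ {n : ℕ} (A : Fin n → Finset ℕ), ProdInj Φ A ∅ ∧ ProdVan Φ A ∅ := by
    refine fun A => ⟨fun i p _ _ hp => ?_, fun t p _ _ => ?_⟩
    · rwa [prodForm_empty, map_one, one_mul] at hp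
    · rw [prodForm_empty, map_one, Ideal.span_singleton_one, sup_top_eq]
      trivial
  induction n generalizing B with
  | zero =>
    rcases B.eq_empty_or_nonempty with rfl | hB
    · exact hempty A
    · have := hB.card_pos
      refine ⟨fun i p _ hi _ => ?_, fun t p hp ht => ?_⟩
      · rw [Finset.univ_eq_empty, Finset.sum_empty] at hi
        omega
      · have : p = 0 := by
          ext m
          rw [coeff_zero, hp.coeff_eq_zero]
          rw [Subsingleton.elim m 0, map_zero]
          omega
        rw [this]
        exact zero_mem _
  | succ n ih =>
    rw [← Fin.snoc_init_self A] at hA hAB ⊢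
    generalize Fin.init A = A' at hA hAB ⊢
    generalize A (Fin.last n) = C at hA hAB ⊢
    have hA' : ∀ i j, i ≠ j → Disjoint (A' i) (A' j) := fun i j hij => by
      simpa using hA i.castSucc j.castSucc (by simpa using hij)
    have hAC : ∀ k, Disjoint (A' k) C := fun k => by
      simpa using hA k.castSucc (Fin.last n) (Fin.castSucc_lt_last k).ne
    have hAB' : ∀ k, Disjoint (A' k) B := fun k => by simpa using hAB k.castSucc
    have hCB : Disjoint C B := by simpa using hAB (Fin.last n)
    clear hA hAB
    induction C using Finset.induction_on generalizing B with
    | empty =>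
      have htop : prodIdeal Φ (n + 1) (Fin.snoc A' ∅ : Fin (n + 1) → Finset ℕ) = ⊤ := by
        rw [prodIdeal_snoc, prodForm_empty, map_one, Ideal.span_singleton_one, sup_top_eq]
      refine ⟨fun i p _ _ _ => ?_, fun t p _ _ => ?_⟩ <;> rw [htop]
      · trivial
      · rw [top_sup_eq]; trivial
    | insert a₀ C ha₀ ihC =>
      rcases B.eq_empty_or_nonempty with rfl | ⟨b₀, hb₀⟩
      · exact hempty _
      · obtain ⟨B, hb, rfl⟩ : ∃ B', b₀ ∉ B' ∧ insert b₀ B' = B :=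
          ⟨B.erase b₀, Finset.notMem_erase _ _, Finset.insert_erase hb₀⟩
        have hAC' : ∀ k, Disjoint (A' k) C := fun k =>
          (hAC k).mono_right (Finset.subset_insert _ _)
        refine prod_step hΦ hA' hAC hAB' hCB ha₀ hb
          (ih A' _ hA' fun k => Finset.disjoint_union_right.2 ⟨hAC' k, hAB' k⟩)
          (ihC B hAC' (fun k => (hAB' k).mono_right (Finset.subset_insert _ _))
            (hCB.mono (Finset.subset_insert _ _) (Finset.subset_insert _ _)))

end Core

section Universal

theorem expDeg_eq_degree {n : ℕ} (μ : Fin n →₀ ℕ) : expDeg μ = μ.degree := rfl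

theorem isHomogeneous_monomial_expDeg {k : Type*} [CommSemiring k] {n : ℕ} (μ : Fin n →₀ ℕ)
    (c : k) : (monomial μ c).IsHomogeneous (expDeg μ) :=
  isHomogeneous_monomial c rfl

variable {n r : ℕ}

/-- Indices for the coefficients of a sequence of forms of degrees `d` in `n` variables. -/
abbrev CoeffIdx (n : ℕ) {r : ℕ} (d : Fin r → ℕ) : Type :=
  Σ i : Fin r, { μ : Fin n →₀ ℕ // expDeg μ = d i }

/-- The forms of degrees `d` whose coefficients are indeterminates. -/
noncomputable def univForm (F : Type*) [Field F] (n : ℕ) (d : Fin r → ℕ) (i : Fin r) :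
    MvPolynomial (Fin n) (MvPolynomial (CoeffIdx n d) F) :=
  ∑ μ ∈ Finset.finsuppAntidiag Finset.univ (d i),
    monomial μ (if h : expDeg μ = d i then X ⟨i, μ, h⟩ else 0)

variable {F : Type*} [Field F] {d : Fin r → ℕ}

theorem coeff_univForm (i : Fin r) (μ : Fin n →₀ ℕ) :
    coeff μ (univForm F n d i) = if h : expDeg μ = d i then X ⟨i, μ, h⟩ else 0 := by
  classical
  rw [univForm, coeff_sum]
  simp only [coeff_monomial]
  rw [Finset.sum_ite_eq']
  split_ifs with h1 h2 h2
  · rfl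
  · rfl
  · refine absurd ?_ h1
    rw [Finset.mem_finsuppAntidiag]
    refine ⟨?_, Finset.subset_univ _⟩
    rw [← h2, expDeg_eq_degree, Finsupp.degree_eq_sum]
  · rfl

theorem isHomogeneous_univForm (i : Fin r) : (univForm F n d i).IsHomogeneous (d i) := by
  intro μ hμ
  rw [coeff_univForm] at hμ
  by_contra h
  refine hμ (dif_neg fun h' => h ?_)
  rw [← h', expDeg_eq_degree]
  exact (congrArg (fun w : (Fin n →₀ ℕ) →+ ℕ => w μ) Finsupp.degree_eq_weight_one).symm

variable {K : Type*} [Field K] [Algebra F K]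

/-- Specialization of the indeterminate coefficients to the coefficients of `f`. -/
noncomputable def coeffHom (F : Type*) [Field F] [Algebra F K] (d : Fin r → ℕ)
    (f : Fin r → MvPolynomial (Fin n) K) : MvPolynomial (CoeffIdx n d) F →+* K :=
  (aeval fun p : CoeffIdx n d => (f p.1).coeff p.2.1 : MvPolynomial (CoeffIdx n d) F →ₐ[F] K)

theorem map_coeffHom_univForm {f : Fin r → MvPolynomial (Fin n) K}
    (hf : ∀ i, (f i).IsHomogeneous (d i)) (i : Fin r) :
    map (coeffHom F d f) (univForm F n d i) = f i := by
  ext μ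
  rw [coeff_map, coeff_univForm]
  split_ifs with h
  · simp [coeffHom]
  · rw [map_zero, (hf i).coeff_eq_zero h]

theorem coeffHom_injective {f : Fin r → MvPolynomial (Fin n) K} (hf : IsGenericSeq F d f) :
    Function.Injective (coeffHom F d f) := hf.2

theorem specIdeal_coeffHom_range {s : ℕ} {f : Fin r → MvPolynomial (Fin n) K}
    (hf : ∀ i, (f i).IsHomogeneous (d i)) (e : Fin s → Fin r) :
    specIdeal (coeffHom F d f) (Set.range fun i => univForm F n d (e i)) =
      Ideal.span (Set.range fun i => f (e i)) := by
  rw [specIdeal, ← Set.range_comp]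
  congr 2
  funext i
  exact map_coeffHom_univForm hf _

end Universal

end GenericForms

theorem IsGenericSeq.comp {F K : Type*} [CommRing F] [CommRing K] [Algebra F K] {n r s : ℕ}
    {d : Fin r → ℕ} {f : Fin r → MvPolynomial (Fin n) K} (hf : IsGenericSeq F d f)
    {e : Fin s → Fin r} (he : Function.Injective e) :
    IsGenericSeq F (fun i => d (e i)) fun i => f (e i) := by
  refine ⟨fun i => hf.1 _, ?_⟩
  refine hf.2.comp (fun p : (Σ i : Fin s, { μ : Fin n →₀ ℕ // expDeg μ = d (e i) }) =>
    (⟨e p.1, p.2⟩ : Σ i : Fin r, { μ : Fin n →₀ ℕ // expDeg μ = d i })) ?_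
  rintro ⟨i, μ, hμ⟩ ⟨j, ν, hν⟩ h
  obtain rfl : i = j := he (Sigma.mk.inj_iff.1 h).1
  simpa using h

theorem IsGenericSeq.init {F K : Type*} [CommRing F] [CommRing K] [Algebra F K] {n r : ℕ}
    {d : Fin r → ℕ} {D : ℕ} {f : Fin r → MvPolynomial (Fin n) K} {g : MvPolynomial (Fin n) K}
    (hf : IsGenericSeq F (Fin.snoc d D : Fin (r + 1) → ℕ)
      (Fin.snoc f g : Fin (r + 1) → MvPolynomial (Fin n) K)) : IsGenericSeq F d f := by
  simpa using hf.comp (Fin.castSucc_injective r)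

namespace GenericForms

section Projection

theorem embExp_castSucc {n : ℕ} (μ : Fin n →₀ ℕ) (j : Fin n) : embExp μ j.castSucc = μ j :=
  Finsupp.embDomain_apply_self ⟨Fin.castSucc, Fin.castSucc_injective n⟩ μ j

theorem embExp_last {n : ℕ} (μ : Fin n →₀ ℕ) : embExp μ (Fin.last n) = 0 :=
  Finsupp.embDomain_of_notMem_range _ _ _ (by simp)

theorem embExp_injective {n : ℕ} : Function.Injective (embExp : (Fin n →₀ ℕ) → _) :=
  Finsupp.embDomain_injective _

theorem embExp_eq_mapDomain {n : ℕ} (μ : Fin n →₀ ℕ) : embExp μ = μ.mapDomain Fin.castSucc :=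
  Finsupp.embDomain_eq_mapDomain _ _

theorem expDeg_embExp {n : ℕ} (μ : Fin n →₀ ℕ) : expDeg (embExp μ) = expDeg μ := by
  rw [expDeg_eq_degree, expDeg_eq_degree, Finsupp.degree_eq_sum, Finsupp.degree_eq_sum,
    Fin.sum_univ_castSucc, embExp_last, add_zero]
  simp only [embExp_castSucc]

theorem exists_embExp_eq {n : ℕ} {μ : Fin (n + 1) →₀ ℕ} (h : μ (Fin.last n) = 0) :
    ∃ ν, embExp ν = μ := by
  refine ⟨μ.comapDomain Fin.castSucc (Fin.castSucc_injective n).injOn, ?_⟩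
  ext i
  refine Fin.lastCases ?_ (fun j => ?_) i
  · rw [embExp_last, h]
  · rw [embExp_castSucc, Finsupp.comapDomain_apply]

theorem coeff_projMap {k : Type*} [CommRing k] {n : ℕ} (p : MvPolynomial (Fin (n + 1)) k)
    (μ : Fin n →₀ ℕ) : coeff μ (projMap k n p) = coeff (embExp μ) p := by
  obtain ⟨c, hc⟩ := Ideal.mem_span_singleton'.1 (sub_rename_projMap_mem p)
  have hp : p = c * X (Fin.last n) + rename Fin.castSucc (projMap k n p) := by
    rw [hc, sub_add_cancel]
  conv_rhs => rw [hp]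
  rw [coeff_add, embExp_eq_mapDomain, coeff_rename_mapDomain _ (Fin.castSucc_injective n),
    ← embExp_eq_mapDomain, coeff_mul_X', if_neg, zero_add]
  rw [Finsupp.mem_support_iff, embExp_last]
  exact fun h => h rfl

theorem map_projMap_span_range {k ι : Type*} [CommRing k] {n : ℕ}
    (f : ι → MvPolynomial (Fin (n + 1)) k) :
    (Ideal.span (Set.range f)).map (projMap k n) =
      Ideal.span (Set.range fun i => projMap k n (f i)) := by
  rw [Ideal.map_span, ← Set.range_comp]
  rfl

end Projection

end GenericForms

open GenericForms in
theorem IsGenericSeq.projMap {F K : Type*} [CommRing F] [CommRing K] [Algebra F K] {n r : ℕ}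
    {d : Fin r → ℕ} {f : Fin r → MvPolynomial (Fin (n + 1)) K} (hf : IsGenericSeq F d f) :
    IsGenericSeq F d fun i => projMap K n (f i) := by
  refine ⟨fun i => isHomogeneous_projMap (hf.1 i), ?_⟩
  simp only [coeff_projMap]
  refine hf.2.comp (fun p : (Σ i : Fin r, { μ : Fin n →₀ ℕ // expDeg μ = d i }) =>
    (⟨p.1, embExp p.2.1, (expDeg_embExp _).trans p.2.2⟩ :
      Σ i : Fin r, { μ : Fin (n + 1) →₀ ℕ // expDeg μ = d i })) ?_
  rintro ⟨i, μ, hμ⟩ ⟨j, ν, hν⟩ h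
  obtain rfl : i = j := (Sigma.mk.inj_iff.1 h).1
  have : embExp μ = embExp ν := by simpa using h
  obtain rfl := embExp_injective this
  rfl

namespace GenericForms

section Generic

variable {F K : Type*} [Field F] [Field K] [Algebra F K] {n : ℕ}

theorem isHomogeneous_of_mem_range {σ k ι : Type*} [CommRing k] {d : ι → ℕ}
    {f : ι → MvPolynomial σ k} (hf : ∀ i, (f i).IsHomogeneous (d i)) :
    ∀ g ∈ Set.range f, ∃ e, g.IsHomogeneous e := by
  rintro _ ⟨i, rfl⟩
  exact ⟨_, hf i⟩

theorem mem_span_range_of_isGenericSeq {d : Fin n → ℕ} {f : Fin n → MvPolynomial (Fin n) K}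
    (hf : IsGenericSeq F d f) {t : ℕ} (ht : ∑ j, d j + 1 ≤ t + n) {p : MvPolynomial (Fin n) K}
    (hp : p.IsHomogeneous t) : p ∈ Ideal.span (Set.range f) := by
  have hX : ∀ i, (X i ^ d i : MvPolynomial (Fin n) F).IsHomogeneous (d i) := fun i =>
    isHomogeneous_X_pow i (d i)
  have := forall_mem_specIdeal_range (coeffHom_injective hf) (p := univForm F n d)
    isHomogeneous_univForm (map_coeffHom_univForm hX) (t := t) (by simpa using ht) p hp
  exact specIdeal_coeffHom_range (F := F) hf.1 id ▸ this

theorem mem_of_X_last_mul_mem {d : Fin n → ℕ} {f : Fin n → MvPolynomial (Fin (n + 1)) K}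
    (hf : IsGenericSeq F d f) {p : MvPolynomial (Fin (n + 1)) K}
    (hp : X (Fin.last n) * p ∈ Ideal.span (Set.range f)) : p ∈ Ideal.span (Set.range f) := by
  have hX : ∀ i : Fin n, (X i.castSucc ^ d i : MvPolynomial (Fin (n + 1)) F).IsHomogeneous (d i) :=
    fun i => isHomogeneous_X_pow _ (d i)
  have := (regular_of_specialization (coeffHom_injective hf) (Fin.castSucc_injective n)
    (p := univForm F (n + 1) d) isHomogeneous_univForm (map_coeffHom_univForm hX)
    Finset.univ).2 (X (Fin.last n)) (Fin.last n) 1 (isHomogeneous_X _ _) (by simp)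
    (fun i _ => (Fin.castSucc_lt_last i).ne) p
  rw [Finset.coe_univ, Set.image_univ, map_X] at this
  exact specIdeal_coeffHom_range (F := F) hf.1 id ▸ this
    ((specIdeal_coeffHom_range (F := F) hf.1 id).symm ▸ hp)

/-- A generic form lies in an ideal that does not depend on it only if all forms do. -/
theorem monomial_mem_of_generic_mem {r : ℕ} {d : Fin r → ℕ} {D : ℕ}
    {f : Fin r → MvPolynomial (Fin n) K} {g : MvPolynomial (Fin n) K}
    (hfg : IsGenericSeq F (Fin.snoc d D : Fin (r + 1) → ℕ)
      (Fin.snoc f g : Fin (r + 1) → MvPolynomial (Fin n) K))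
    {M : Set (Fin n →₀ ℕ)}
    (hg : g ∈ Ideal.span (Set.range f ∪ (fun κ => monomial κ (1 : K)) '' M)) {ν : Fin n →₀ ℕ}
    (hν : expDeg ν = D) :
    monomial ν (1 : K) ∈ Ideal.span (Set.range f ∪ (fun κ => monomial κ (1 : K)) '' M) := by
  by_contra hcon
  set L := Ideal.span (Set.range f ∪ (fun κ => monomial κ (1 : K)) '' M) with hL
  let d' : Fin (r + 1) → ℕ := Fin.snoc d D
  let U := univForm F n d'
  let G := Set.range (fun i : Fin r => U i.castSucc) ∪ (fun κ => monomial κ 1) '' M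
  have key : ∀ h : MvPolynomial (Fin n) K, h.IsHomogeneous D →
      specIdeal (coeffHom F d' (Fin.snoc f h : Fin (r + 1) → MvPolynomial (Fin n) K)) G = L ∧
      map (coeffHom F d' (Fin.snoc f h : Fin (r + 1) → MvPolynomial (Fin n) K))
        (U (Fin.last r)) = h := by
    intro h hh
    have hhom : ∀ i, ((Fin.snoc f h : Fin (r + 1) → MvPolynomial (Fin n) K) i).IsHomogeneous
        (d' i) := by
      intro i
      refine Fin.lastCases ?_ (fun j => ?_) i
      · simpa [d'] using hh
      · simpa [d'] using hfg.1 j.castSucc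
    constructor
    · rw [specIdeal, Set.image_union, ← Set.range_comp, Set.image_image, hL]
      congr 2
      · congr 1
        funext i
        simpa using map_coeffHom_univForm hhom i.castSucc
      · simp
    · simpa using map_coeffHom_univForm hhom (Fin.last r)
  have h1 := key g (by simpa using hfg.1 (Fin.last r))
  have h2 := key (monomial ν 1) (hν ▸ isHomogeneous_monomial_expDeg ν 1)
  have := (injective_of_specialization (coeffHom_injective hfg)
    (Ψ := coeffHom F d' (Fin.snoc f (monomial ν 1) : Fin (r + 1) → MvPolynomial (Fin n) K))
    (G := G) (g := U (Fin.last r)) (d := D) (i := 0) ?_ ?_ ?_ ?_ ?_).1 1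
    (isHomogeneous_one _ _)
  · rw [h1.1, h1.2, mul_one] at this
    exact hcon (by simpa using L.mul_mem_left (monomial ν 1) (this hg))
  · rintro _ (⟨i, rfl⟩ | ⟨κ, -, rfl⟩)
    · exact ⟨_, isHomogeneous_univForm _⟩
    · exact ⟨_, isHomogeneous_monomial_expDeg κ _⟩
  · simpa [d'] using isHomogeneous_univForm (F := F) (n := n) (d := d') (Fin.last r)
  · rw [h1.1, h2.1]
  · rw [h1.1, h2.1]
  · intro p hp
    rw [h2.1, h2.2]
    intro hpL
    obtain ⟨c, rfl⟩ : ∃ c, p = C c := ⟨_, totalDegree_eq_zero_iff_eq_C.1 (by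
      exact Nat.le_zero.1 hp.totalDegree_le)⟩
    rcases eq_or_ne c 0 with rfl | hc
    · rw [map_zero]; exact zero_mem _
    · refine absurd ?_ hcon
      have := L.mul_mem_left (C c⁻¹) hpL
      rwa [mul_left_comm, ← C_mul, inv_mul_cancel₀ hc, C_1, mul_one] at this

theorem hilb_generic_eq_prodIdeal {K₁ : Type*} [Field K₁] (hn : 0 < n) {d : Fin n → ℕ} {D : ℕ}
    {f : Fin (n + 1) → MvPolynomial (Fin n) K}
    (hf : IsGenericSeq F (Fin.snoc d D : Fin (n + 1) → ℕ) f)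
    {Φ : MvPolynomial (ℕ × ℕ) F →+* K₁} (hΦ : Function.Injective Φ)
    {A : Fin n → Finset ℕ} (hA : ∀ i j, i ≠ j → Disjoint (A i) (A j)) (hd : ∀ k, (A k).card = d k)
    (t : ℕ) :
    hilb (specIdeal (coeffHom F (Fin.snoc d D : Fin (n + 1) → ℕ) f)
      (Set.range fun i : Fin n => univForm F n (Fin.snoc d D : Fin (n + 1) → ℕ) i.castSucc)) t =
      hilb (prodIdeal Φ n A) t := by
  let d' : Fin (n + 1) → ℕ := Fin.snoc d D
  let x : Fin (n + 1) → MvPolynomial (Fin n) F := Fin.snoc (fun i => X i ^ d i) 0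
  have hx : ∀ i, (x i).IsHomogeneous (d' i) := by
    intro i
    refine Fin.lastCases ?_ (fun j => ?_) i
    · simpa [x] using isHomogeneous_zero _ _ _
    · simpa [x, d'] using isHomogeneous_X_pow j (d j)
  have hU : ∀ i : Fin n, (univForm F n d' i.castSucc).IsHomogeneous (d i) := fun i => by
    simpa [d'] using isHomogeneous_univForm (F := F) (n := n) (d := d') i.castSucc
  have hxU : ∀ i : Fin n, map (coeffHom F d' x) (univForm F n d' i.castSucc) = X i ^ d i :=
    fun i => by simpa [x] using map_coeffHom_univForm hx i.castSucc
  obtain ⟨s, hs, -⟩ := exists_select hA id (⟨0, hn⟩ : Fin n)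
  have hp : ∀ i, (prodForm F n (A i)).IsHomogeneous (d i) := fun i =>
    hd i ▸ isHomogeneous_prodForm n (A i)
  have hsp : ∀ i, map (selectHom F s) (prodForm F n (A i)) = X i ^ d i := fun i => by
    rw [map_selectHom_prodForm s (hs i), hd]
    rfl
  have h1 := (regular_of_specialization (coeffHom_injective hf) Function.injective_id hU hxU
    Finset.univ).1 t
  have h2 := (regular_of_specialization hΦ Function.injective_id hp hsp Finset.univ).1 t
  rw [Finset.coe_univ, Set.image_univ] at h1 h2
  rw [prodIdeal, h1, h2, specIdeal, specIdeal, ← Set.range_comp, ← Set.range_comp]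
  simp only [Function.comp_def, hsp]
  congr 4
  funext i
  exact hxU i

/-- Generic forms have maximal rank modulo generic complete intersections in the degrees forced
by symmetry. -/
theorem maximalRank_generic (hn : 0 < n) {d : Fin n → ℕ} {D : ℕ}
    {f : Fin n → MvPolynomial (Fin n) K} {g : MvPolynomial (Fin n) K}
    (hfg : IsGenericSeq F (Fin.snoc d D : Fin (n + 1) → ℕ)
      (Fin.snoc f g : Fin (n + 1) → MvPolynomial (Fin n) K)) :
    (∀ (i : ℕ) (p : MvPolynomial (Fin n) K), p.IsHomogeneous i → 2 * i + D + n ≤ ∑ k, d k →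
      g * p ∈ Ideal.span (Set.range f) → p ∈ Ideal.span (Set.range f)) ∧
    ∀ (t : ℕ) (p : MvPolynomial (Fin n) K), p.IsHomogeneous t → ∑ k, d k + D ≤ 2 * t + n →
      p ∈ Ideal.span (Set.range f) ⊔ Ideal.span {g} := by
  let K₁ := FractionRing (MvPolynomial (ℕ × ℕ) F)
  let Φ : MvPolynomial (ℕ × ℕ) F →+* K₁ := algebraMap _ _
  have hΦ : Function.Injective Φ := IsFractionRing.injective _ _
  have : Infinite K₁ := Infinite.of_injective _ hΦ
  let A : Fin n → Finset ℕ := fun k => (Finset.range (d k)).image (Nat.pair k)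
  let B : Finset ℕ := (Finset.range D).image (Nat.pair n)
  have hpair : ∀ k (s : Finset ℕ), (s.image (Nat.pair k)).card = s.card := fun k s =>
    Finset.card_image_of_injective s fun a b h => (Nat.pair_eq_pair.1 h).2
  have hdisj : ∀ (k l : ℕ) (s s' : Finset ℕ), k ≠ l →
      Disjoint (s.image (Nat.pair k)) (s'.image (Nat.pair l)) := by
    intro k l s s' hkl
    rw [Finset.disjoint_left]
    intro a ha ha'
    obtain ⟨b, -, rfl⟩ := Finset.mem_image.1 ha
    obtain ⟨c, -, hc⟩ := Finset.mem_image.1 ha'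
    exact hkl (Nat.pair_eq_pair.1 hc).1.symm
  have hA : ∀ i j, i ≠ j → Disjoint (A i) (A j) := fun i j hij =>
    hdisj _ _ _ _ fun h => hij (Fin.ext h)
  have hAB : ∀ k, Disjoint (A k) B := fun k => hdisj _ _ _ _ k.2.ne
  have hAd : ∀ k, (A k).card = d k := fun k => (hpair _ _).trans (Finset.card_range _)
  have hBD : B.card = D := (hpair _ _).trans (Finset.card_range _)
  obtain ⟨hinj, hvan⟩ := prodInj_and_prodVan hΦ A B hA hAB
  let d' : Fin (n + 1) → ℕ := Fin.snoc d D
  let q : Fin (n + 1) → MvPolynomial (Fin n) K₁ :=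
    Fin.snoc (fun k => map Φ (prodForm F n (A k))) (map Φ (prodForm F n B))
  have hq : ∀ i, (q i).IsHomogeneous (d' i) := by
    intro i
    refine Fin.lastCases ?_ (fun j => ?_) i
    · simpa [q, d', hBD] using (isHomogeneous_prodForm (F := F) n B).map Φ
    · simpa [q, d', hAd] using (isHomogeneous_prodForm (F := F) n (A j)).map Φ
  let Ψ := coeffHom F d' q
  let U := univForm F n d'
  let G := Set.range fun i : Fin n => U i.castSucc
  have hG : ∀ u ∈ G, ∃ e, u.IsHomogeneous e :=
    isHomogeneous_of_mem_range fun i => isHomogeneous_univForm i.castSucc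
  have hgU : (U (Fin.last n)).IsHomogeneous D := by
    simpa [d'] using isHomogeneous_univForm (F := F) (n := n) (d := d') (Fin.last n)
  have hΨG : specIdeal Ψ G = prodIdeal Φ n A := by
    rw [specIdeal_coeffHom_range hq Fin.castSucc, prodIdeal, specIdeal, ← Set.range_comp]
    simp [q, Function.comp_def]
  have hΨg : map Ψ (U (Fin.last n)) = map Φ (prodForm F n B) := by
    simpa [q] using map_coeffHom_univForm hq (Fin.last n)
  set f' : Fin (n + 1) → MvPolynomial (Fin n) K := Fin.snoc f g with hf'
  have hΞG : specIdeal (coeffHom F d' f') G = Ideal.span (Set.range f) := by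
    rw [specIdeal_coeffHom_range hfg.1 Fin.castSucc]
    simp [hf']
  have hΞg : map (coeffHom F d' f') (U (Fin.last n)) = g := by
    simpa [hf'] using map_coeffHom_univForm hfg.1 (Fin.last n)
  have hilb_eq : ∀ t, hilb (specIdeal (coeffHom F d' f') G) t = hilb (specIdeal Ψ G) t := by
    intro t
    rw [hΨG]
    exact hilb_generic_eq_prodIdeal hn hfg hΦ hA hAd t
  constructor
  · intro i p hp hi hpJ
    have := (injective_of_specialization (coeffHom_injective hfg) hG hgU (hilb_eq i)
      (hilb_eq (i + D)) (fun r hr => by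
        rw [hΨG, hΨg]
        exact hinj i r hr (by simpa only [hAd, hBD] using hi))).1 p hp
    rw [hΞG, hΞg] at this
    exact this hpJ
  · intro t p hp ht
    have := forall_mem_specIdeal_of_specialization (coeffHom_injective hfg) (Ψ := Ψ)
      (G := insert (U (Fin.last n)) G) (t := t) (by
        rintro x (rfl | hx)
        · exact ⟨_, hgU⟩
        · exact hG x hx) (fun r hr => by
        rw [specIdeal_insert, hΨG, hΨg]
        exact hvan t r hr (by simpa only [hAd, hBD] using ht)) p hp
    rwa [specIdeal_insert, hΞG, hΞg] at this

end Generic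

section Order

variable {n : ℕ}

theorem drlLT_irrefl (a : Fin n →₀ ℕ) : ¬DrlLT a a := by
  rintro (h | ⟨-, i, h, -⟩) <;> exact lt_irrefl _ h

theorem drlLT_trans {a b c : Fin n →₀ ℕ} (hab : DrlLT a b) (hbc : DrlLT b c) : DrlLT a c := by
  rcases hab with hab | ⟨hab, i, hi, hij⟩ <;> rcases hbc with hbc | ⟨hbc, j, hj, hjk⟩
  · exact Or.inl (hab.trans hbc)
  · exact Or.inl (hab.trans_eq hbc)
  · exact Or.inl (hab.trans_lt hbc)
  · refine Or.inr ⟨hab.trans hbc, ?_⟩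
    rcases lt_trichotomy i j with h | rfl | h
    · exact ⟨j, by rwa [hij j h], fun k hk => (hij k (h.trans hk)).trans (hjk k hk)⟩
    · exact ⟨i, hj.trans hi, fun k hk => (hij k hk).trans (hjk k hk)⟩
    · exact ⟨i, by rwa [← hjk i h], fun k hk => (hij k hk).trans (hjk k (h.trans hk))⟩

theorem drlLT_add_right_iff {a b : Fin n →₀ ℕ} (c : Fin n →₀ ℕ) :
    DrlLT (a + c) (b + c) ↔ DrlLT a b := by
  simp only [DrlLT, expDeg_eq_degree, map_add, Finsupp.add_apply, add_lt_add_iff_right,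
    add_left_inj]

theorem drlLT_embExp_iff {a b : Fin n →₀ ℕ} : DrlLT (embExp a) (embExp b) ↔ DrlLT a b := by
  simp only [DrlLT, expDeg_embExp]
  refine or_congr_right (and_congr_right fun _ => ⟨?_, ?_⟩)
  · rintro ⟨i, hi, hij⟩
    induction i using Fin.lastCases with
    | last => simp [embExp_last] at hi
    | cast i =>
      refine ⟨i, by simpa only [embExp_castSucc] using hi, fun j hj => ?_⟩
      simpa only [embExp_castSucc] using hij j.castSucc (Fin.castSucc_lt_castSucc_iff.2 hj)
  · rintro ⟨i, hi, hij⟩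
    refine ⟨i.castSucc, by simpa only [embExp_castSucc] using hi, fun j hj => ?_⟩
    induction j using Fin.lastCases with
    | last => rw [embExp_last, embExp_last]
    | cast j =>
      simpa only [embExp_castSucc] using hij j (Fin.castSucc_lt_castSucc_iff.1 hj)

theorem eq_of_le_of_expDeg_eq {a b : Fin n →₀ ℕ} (h : a ≤ b) (hd : expDeg a = expDeg b) :
    a = b := by
  obtain ⟨c, rfl⟩ := exists_add_of_le h
  rw [expDeg_eq_degree, expDeg_eq_degree, map_add, left_eq_add, Finsupp.degree_eq_zero_iff] at hd
  rw [hd, add_zero]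

end Order

section InitialIdeal

variable {k : Type*} [Field k] {n : ℕ}

theorem expDeg_eq_of_mem_support {p : MvPolynomial (Fin n) k} {t : ℕ} (hp : p.IsHomogeneous t)
    {κ : Fin n →₀ ℕ} (h : κ ∈ p.support) : expDeg κ = t := by
  by_contra hne
  exact mem_support_iff.1 h (hp.coeff_eq_zero hne)

theorem isLeadExp_mul_monomial_iff {p : MvPolynomial (Fin n) k} {μ c : Fin n →₀ ℕ} :
    IsLeadExp (p * monomial c 1) (μ + c) ↔ IsLeadExp p μ := by
  simp only [IsLeadExp, mem_support_iff, coeff_mul_monomial, mul_one]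
  refine and_congr_right fun _ => ⟨fun h κ hκ hne => ?_, fun h κ hκ hne => ?_⟩
  · refine (drlLT_add_right_iff c).1 (h (κ + c) ?_ fun h' => hne (add_right_cancel h'))
    rwa [coeff_mul_monomial, mul_one]
  · rw [coeff_mul_monomial'] at hκ
    split_ifs at hκ with hc
    · obtain ⟨κ, rfl⟩ := exists_add_of_le hc
      rw [add_comm c κ] at hne ⊢
      rw [add_tsub_cancel_left, mul_one] at hκ
      exact (drlLT_add_right_iff c).2 (h κ hκ fun h' => hne (by rw [h']))
    · exact absurd rfl hκ

theorem isLeadExp_monomial (μ : Fin n →₀ ℕ) : IsLeadExp (monomial μ (1 : k)) μ := by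
  refine ⟨by simp, fun ν hν hne => ?_⟩
  rw [mem_support_iff, coeff_monomial] at hν
  exact absurd (by by_contra h; exact hν (if_neg fun h' => h h'.symm)) hne

theorem monomial_mem_initialIdeal_iff {I : Ideal (MvPolynomial (Fin n) k)} {μ : Fin n →₀ ℕ} :
    monomial μ (1 : k) ∈ initialIdeal I ↔ ∃ p ∈ I, IsLeadExp p μ := by
  constructor
  · intro h
    have hset : { m | ∃ p ∈ I, p ≠ 0 ∧ ∃ μ, IsLeadExp p μ ∧ m = monomial μ (1 : k) } =
        (fun s => monomial s (1 : k)) '' { μ | ∃ p ∈ I, IsLeadExp p μ } := by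
      ext m
      constructor
      · rintro ⟨p, hp, -, ν, hν, rfl⟩
        exact ⟨ν, ⟨p, hp, hν⟩, rfl⟩
      · rintro ⟨ν, ⟨p, hp, hν⟩, rfl⟩
        refine ⟨p, hp, ?_, ν, hν, rfl⟩
        rintro rfl
        simpa using hν.1
    rw [initialIdeal, hset, mem_ideal_span_monomial_image] at h
    obtain ⟨ν, ⟨p, hp, hν⟩, hle⟩ := h μ (by simp)
    obtain ⟨c, rfl⟩ := exists_add_of_le hle
    exact ⟨p * monomial c 1, I.mul_mem_right _ hp, isLeadExp_mul_monomial_iff.2 hν⟩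
  · rintro ⟨p, hp, hμ⟩
    refine Ideal.subset_span ⟨p, hp, ?_, μ, hμ, rfl⟩
    rintro rfl
    simpa using hμ.1

theorem monomial_mem_initialIdeal_of_mem {I : Ideal (MvPolynomial (Fin n) k)} {μ : Fin n →₀ ℕ}
    (h : monomial μ (1 : k) ∈ I) : monomial μ (1 : k) ∈ initialIdeal I :=
  monomial_mem_initialIdeal_iff.2 ⟨_, h, isLeadExp_monomial μ⟩

theorem exists_homogeneous_of_monomial_mem_initialIdeal {I : Ideal (MvPolynomial (Fin n) k)}
    (hI : IsHomIdeal I) {μ : Fin n →₀ ℕ} (h : monomial μ (1 : k) ∈ initialIdeal I) :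
    ∃ p ∈ I, p.IsHomogeneous (expDeg μ) ∧ IsLeadExp p μ := by
  obtain ⟨p, hp, hμ⟩ := monomial_mem_initialIdeal_iff.1 h
  refine ⟨_, hI p hp (expDeg μ), homogeneousComponent_isHomogeneous _ _, ?_, fun ν hν => ?_⟩
  · rw [mem_support_iff, coeff_homogeneousComponent, if_pos (expDeg_eq_degree μ).symm]
    exact mem_support_iff.1 hμ.1
  · refine hμ.2 ν ?_
    rw [mem_support_iff, coeff_homogeneousComponent] at hν
    rw [mem_support_iff]
    exact fun h' => hν (by rw [h', ite_self])

theorem initialIdeal_mono {I J : Ideal (MvPolynomial (Fin n) k)} (h : I ≤ J) :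
    initialIdeal I ≤ initialIdeal J := by
  refine Ideal.span_mono ?_
  rintro m ⟨p, hp, hm⟩
  exact ⟨p, h hp, hm⟩

theorem isLeadExp_projMap_iff {p : MvPolynomial (Fin (n + 1)) k} {t : ℕ} (hp : p.IsHomogeneous t)
    {ν : Fin n →₀ ℕ} : IsLeadExp (projMap k n p) ν ↔ IsLeadExp p (embExp ν) := by
  simp only [IsLeadExp, mem_support_iff, coeff_projMap]
  refine and_congr_right fun hν => ⟨fun h κ hκ hne => ?_, fun h κ hκ hne => ?_⟩
  · by_cases hlast : κ (Fin.last n) = 0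
    · obtain ⟨κ, rfl⟩ := exists_embExp_eq hlast
      exact drlLT_embExp_iff.2 (h κ hκ fun h' => hne (by rw [h']))
    · refine Or.inr ⟨?_, Fin.last n, ?_, fun j hj => absurd hj (Fin.le_last j).not_gt⟩
      · rw [expDeg_eq_of_mem_support hp (mem_support_iff.2 hκ),
          expDeg_eq_of_mem_support hp (mem_support_iff.2 hν)]
      · rw [embExp_last]
        exact Nat.pos_of_ne_zero hlast
  · exact drlLT_embExp_iff.1 (h _ hκ fun h' => hne (embExp_injective h'))

theorem monomial_embExp_mem_initialIdeal_iff {L : Ideal (MvPolynomial (Fin (n + 1)) k)}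
    (hL : IsHomIdeal L) {ν : Fin n →₀ ℕ} :
    monomial (embExp ν) (1 : k) ∈ initialIdeal L ↔
      monomial ν (1 : k) ∈ initialIdeal (L.map (projMap k n)) := by
  constructor
  · intro h
    obtain ⟨p, hp, hph, hν⟩ := exists_homogeneous_of_monomial_mem_initialIdeal hL h
    exact monomial_mem_initialIdeal_iff.2
      ⟨_, Ideal.mem_map_of_mem _ hp, (isLeadExp_projMap_iff hph).2 hν⟩
  · intro h
    obtain ⟨q, hq, hν⟩ := monomial_mem_initialIdeal_iff.1 h
    obtain ⟨p, hp, rfl⟩ := (Ideal.mem_map_iff_of_surjective _ projMap_surjective).1 hq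
    refine monomial_mem_initialIdeal_iff.2 ⟨_, hL p hp (expDeg ν),
      (isLeadExp_projMap_iff (homogeneousComponent_isHomogeneous _ _)).1 ⟨?_, fun κ hκ => ?_⟩⟩
    · rw [mem_support_iff, coeff_projMap, coeff_homogeneousComponent,
        if_pos ((expDeg_eq_degree _).symm.trans (expDeg_embExp ν)), ← coeff_projMap]
      exact mem_support_iff.1 hν.1
    · refine hν.2 κ ?_
      rw [mem_support_iff, coeff_projMap, coeff_homogeneousComponent] at hκ
      rw [mem_support_iff, coeff_projMap]
      exact fun h' => hκ (by rw [h', ite_self])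

theorem projMap_eq_zero_of_isLeadExp {p : MvPolynomial (Fin (n + 1)) k} {t : ℕ}
    (hp : p.IsHomogeneous t) {μ : Fin (n + 1) →₀ ℕ} (hμ : IsLeadExp p μ)
    (hlast : μ (Fin.last n) ≠ 0) : projMap k n p = 0 := by
  ext κ
  rw [coeff_projMap, coeff_zero]
  by_contra hκ
  rw [← ne_eq, ← mem_support_iff] at hκ
  rcases hμ.2 _ hκ (by rintro rfl; exact hlast (embExp_last κ)) with h | ⟨-, i, hi, hij⟩
  · rw [expDeg_eq_of_mem_support hp hκ, expDeg_eq_of_mem_support hp hμ.1] at h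
    exact lt_irrefl _ h
  · rcases (Fin.le_last i).eq_or_lt with rfl | hlt
    · rw [embExp_last] at hi
      exact Nat.not_lt_zero _ hi
    · exact hlast ((hij _ hlt).symm.trans (embExp_last κ))

theorem isLeadExp_of_mul_X {p : MvPolynomial (Fin n) k} {μ : Fin n →₀ ℕ} {i : Fin n}
    (h : IsLeadExp (p * X i) μ) (hi : μ i ≠ 0) : IsLeadExp p (μ - Finsupp.single i 1) := by
  have hle : Finsupp.single i 1 ≤ μ := Finsupp.single_le_iff.2 (Nat.one_le_iff_ne_zero.2 hi)
  rwa [← isLeadExp_mul_monomial_iff (c := Finsupp.single i 1), tsub_add_cancel_of_le hle]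

/-- If `x^ν` is congruent, modulo an ideal, to a combination of smaller monomials of the same
degree, then it lies in the initial ideal. -/
theorem monomial_mem_initialIdeal_of_mem_sup {I : Ideal (MvPolynomial (Fin n) k)}
    (hI : IsHomIdeal I) {ν : Fin n →₀ ℕ}
    (h : monomial ν (1 : k) ∈ I ⊔ Ideal.span ((fun κ => monomial κ (1 : k)) ''
      { κ | expDeg κ = expDeg ν ∧ DrlLT κ ν })) : monomial ν (1 : k) ∈ initialIdeal I := by
  obtain ⟨j, hj, s, hs, hjs⟩ := Submodule.mem_sup.1 h
  rw [mem_ideal_span_monomial_image] at hs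
  have hlt : ∀ κ ∈ s.support, expDeg κ = expDeg ν → DrlLT κ ν := by
    intro κ hκ hd
    obtain ⟨κ', ⟨hd', hlt⟩, hle⟩ := hs κ hκ
    rwa [← eq_of_le_of_expDeg_eq hle (hd'.trans hd.symm)]
  have hcoeff : ∀ κ, coeff κ j = coeff κ (monomial ν 1) - coeff κ s := fun κ => by
    rw [← hjs, coeff_add, add_sub_cancel_right]
  have hsν : coeff ν s = 0 := by
    by_contra h
    exact drlLT_irrefl ν (hlt ν (mem_support_iff.2 h) rfl)
  refine monomial_mem_initialIdeal_iff.2 ⟨_, hI j hj (expDeg ν), ?_, fun κ hκ hne => ?_⟩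
  · rw [mem_support_iff, coeff_homogeneousComponent, if_pos (expDeg_eq_degree ν).symm, hcoeff,
      hsν, coeff_monomial, if_pos rfl, sub_zero]
    exact one_ne_zero
  · rw [mem_support_iff, coeff_homogeneousComponent] at hκ
    split_ifs at hκ with hd
    · refine hlt κ (mem_support_iff.2 fun h0 => hκ ?_) hd
      rw [hcoeff, h0, coeff_monomial, if_neg hne.symm, sub_zero]
    · exact absurd rfl hκ

end InitialIdeal

section Main

variable {F K : Type*} [Field F] [Field K] [Algebra F K] {n : ℕ}

/-- In large degrees the initial ideal of a generic complete intersection contains all monomials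
avoiding the last variable. -/
theorem monomial_mem_initialIdeal_of_generic {d : Fin (n + 1) → ℕ}
    {f : Fin (n + 1) → MvPolynomial (Fin (n + 1)) K} (hf : IsGenericSeq F d f) {t : ℕ}
    (ht : 0 < t) (h : ∑ j : Fin n, d j.castSucc + 1 ≤ t + n ∨ ∑ j, d j ≤ 2 * t + n)
    {ν : Fin (n + 1) →₀ ℕ} (hν : expDeg ν = t) (hlast : ν (Fin.last n) = 0) :
    monomial ν (1 : K) ∈ initialIdeal (Ideal.span (Set.range f)) := by
  obtain ⟨ν, rfl⟩ := exists_embExp_eq hlast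
  rw [expDeg_embExp] at hν
  rw [monomial_embExp_mem_initialIdeal_iff (isHomIdeal_span (isHomogeneous_of_mem_range hf.1)),
    map_projMap_span_range]
  refine monomial_mem_initialIdeal_of_mem ?_
  have hνh := hν ▸ isHomogeneous_monomial_expDeg ν (1 : K)
  rcases Nat.eq_zero_or_pos n with rfl | hn
  · rw [Subsingleton.elim ν 0, expDeg_eq_degree, map_zero] at hν
    omega
  have hp := hf.projMap
  rw [range_fin_succ_eq_insert, Ideal.span_insert, sup_comm]
  rcases h with h | h
  · exact Ideal.mem_sup_left
      (mem_span_range_of_isGenericSeq (hp.comp (Fin.castSucc_injective n)) h hνh)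
  · refine (maximalRank_generic (F := F) (d := fun j => d j.castSucc) (D := d (Fin.last n)) hn ?_).2
      t _ hνh (by rwa [Fin.sum_univ_castSucc] at h)
    convert hp using 1
    · exact Fin.snoc_init_self d
    · exact Fin.snoc_init_self fun i => projMap K n (f i)

/-- Below the critical degree, multiplication by the last variable is injective modulo a generic
almost complete intersection. -/
theorem mem_of_mul_X_last_mem {d : Fin n → ℕ} {D : ℕ} (hn : 0 < n)
    {f : Fin n → MvPolynomial (Fin (n + 1)) K} {g : MvPolynomial (Fin (n + 1)) K}
    (hfg : IsGenericSeq F (Fin.snoc d D : Fin (n + 1) → ℕ)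
      (Fin.snoc f g : Fin (n + 1) → MvPolynomial (Fin (n + 1)) K))
    {p : MvPolynomial (Fin (n + 1)) K} {t : ℕ} (hp : (p * X (Fin.last n)).IsHomogeneous t)
    (ht : 2 * t + n < ∑ j, d j + D)
    (hmem : p * X (Fin.last n) ∈ Ideal.span (Set.range f) ⊔ Ideal.span {g}) :
    p ∈ Ideal.span (Set.range f) ⊔ Ideal.span {g} := by
  have hf := hfg.init
  have hg : g.IsHomogeneous D := by simpa using hfg.1 (Fin.last n)
  have hproj : IsGenericSeq F (Fin.snoc d D : Fin (n + 1) → ℕ)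
      (Fin.snoc (fun i => projMap K n (f i)) (projMap K n g) :
        Fin (n + 1) → MvPolynomial (Fin n) K) := by
    convert hfg.projMap using 1
    funext i
    refine Fin.lastCases ?_ (fun j => ?_) i <;> simp
  set I := Ideal.span (Set.range f) with hI
  obtain ⟨b, hb, hb0, hbI⟩ := IsHomIdeal.exists_homogeneous_cofactor
    (isHomIdeal_span (isHomogeneous_of_mem_range hf.1)) hg hp hmem
  have hbJ : projMap K n b ∈ I.map (projMap K n) := by
    rcases lt_or_ge t D with h | h
    · rw [hb0 h, map_zero]
      exact zero_mem _
    · have := Ideal.mem_map_of_mem (projMap K n) hbI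
      rw [map_sub, map_mul, map_mul, projMap_X_last, mul_zero, zero_sub, neg_mem_iff,
        mul_comm] at this
      rw [map_projMap_span_range] at this
      rw [hI, map_projMap_span_range]
      exact (maximalRank_generic hn hproj).1 _ _ (isHomogeneous_projMap hb) (by omega) this
  obtain ⟨u, hu, v, hv, huv⟩ := Submodule.mem_sup.1 (mem_sup_span_X_last_iff.2 hbJ)
  obtain ⟨c, rfl⟩ := Ideal.mem_span_singleton'.1 hv
  have hpc : p - c * g ∈ I := by
    refine mem_of_X_last_mul_mem hf ?_
    have := add_mem hbI (I.mul_mem_right g hu)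
    rw [← huv] at this
    convert this using 1
    ring
  rw [← sub_add_cancel p (c * g)]
  exact Submodule.add_mem_sup hpc (Ideal.mem_span_singleton'.2 ⟨c, rfl⟩)

theorem isMinGen_of_embExp {I Ig : Ideal (MvPolynomial (Fin (n + 1)) K)} (hIg : IsHomIdeal Ig)
    (hle : I ≤ Ig) {μ : Fin n →₀ ℕ} (hμ : IsMinGen (initialIdeal Ig) (embExp μ))
    (hμJ : monomial μ (1 : K) ∈ initialIdeal (I.map (projMap K n))) :
    IsMinGen (initialIdeal (I.map (projMap K n))) μ := by
  refine ⟨hμJ, fun κ hle' hne h => ?_⟩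
  refine hμ.2 (embExp κ) (fun i => ?_) (fun h' => hne (embExp_injective h')) ?_
  · refine Fin.lastCases ?_ (fun j => ?_) i
    · rw [embExp_last, embExp_last]
    · rw [embExp_castSucc, embExp_castSucc]
      exact hle' j
  · rw [monomial_embExp_mem_initialIdeal_iff hIg]
    exact initialIdeal_mono (Ideal.map_mono hle) h

/-- If an element of degree `D` of `(f, g)` that involves the generic form `g` of degree `D` has
leading monomial `x^μ`, then every larger monomial of degree `D` is a leading monomial of `(f)`. -/
theorem monomial_mem_initialIdeal_of_generic_lead {r : ℕ} {d : Fin r → ℕ} {D : ℕ}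
    {f : Fin r → MvPolynomial (Fin n) K} {g : MvPolynomial (Fin n) K}
    (hfg : IsGenericSeq F (Fin.snoc d D : Fin (r + 1) → ℕ)
      (Fin.snoc f g : Fin (r + 1) → MvPolynomial (Fin n) K))
    {p : MvPolynomial (Fin n) K} (hp : p.IsHomogeneous D) {μ ν : Fin n →₀ ℕ}
    (hμ : IsLeadExp p μ) (hμν : DrlLT μ ν) (hν : expDeg ν = D) {c : K} (hc : c ≠ 0)
    (hpg : p - C c * g ∈ Ideal.span (Set.range f)) :
    monomial ν (1 : K) ∈ initialIdeal (Ideal.span (Set.range f)) := by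
  have hI := isHomIdeal_span (isHomogeneous_of_mem_range hfg.init.1)
  refine monomial_mem_initialIdeal_of_mem_sup hI ?_
  rw [← Ideal.span_union]
  refine monomial_mem_of_generic_mem hfg ?_ hν
  rw [Ideal.span_union]
  set L := Ideal.span (Set.range f) ⊔ Ideal.span ((fun κ => monomial κ (1 : K)) ''
      { κ | expDeg κ = expDeg ν ∧ DrlLT κ ν }) with hL
  have hpL : p ∈ L := by
    refine Ideal.mem_sup_right (mem_ideal_span_monomial_image.2 fun κ hκ => ⟨κ, ⟨?_, ?_⟩, le_rfl⟩)
    · rw [expDeg_eq_of_mem_support hp hκ, hν]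
    · rcases eq_or_ne κ μ with rfl | hne
      · exact hμν
      · exact drlLT_trans (hμ.2 κ hκ hne) hμν
  have hcg : C c * g ∈ L := by
    have := L.sub_mem hpL (Ideal.mem_sup_left hpg)
    rwa [sub_sub_cancel] at this
  have := L.mul_mem_left (C c⁻¹) hcg
  rwa [← mul_assoc, ← C_mul, inv_mul_cancel₀ hc, C_1, one_mul] at this

end Main

end GenericForms

open GenericForms

/-- if `d ≥ σ` and Conjecture E holds for `J = π(I)`, then Conjecture E holds
for the generic ideal `(I,g)` of type `(n+1; d_1,…,d_n,d)`. -/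
theorem stmt11 {F K : Type*} [Field F] [Field K] [Algebra F K] [Infinite K]
    {n : ℕ} (hn : 0 < n) (d : Fin n → ℕ) (hd : ∀ i, 1 ≤ d i) (hmono : Monotone d)
    (D : ℕ) (hdD : ∀ i, d i ≤ D)
    (f : Fin n → MvPolynomial (Fin (n + 1)) K) (g : MvPolynomial (Fin (n + 1)) K)
    (hfg : IsGenericSeq F (Fin.snoc d D) (Fin.snoc f g))
    (I Ig : Ideal (MvPolynomial (Fin (n + 1)) K))
    (hI : I = Ideal.span (Set.range f)) (hIg : Ig = Ideal.span (Set.range (Fin.snoc f g)))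
    (J : Ideal (MvPolynomial (Fin n) K)) (hJ : J = I.map (projMap K n))
    (δ δs σ : ℕ) (hδ : δ = (∑ j, d j) - n)
    (hδs : δs = (∑ j ∈ Finset.univ.filter (fun j : Fin n => (j : ℕ) < n - 1), d j) - (n - 1))
    (hσ : σ = min δs (δ / 2)) (hσD : σ ≤ D)
    (hE : ConjE J) : ConjE Ig := by
  obtain ⟨n, rfl⟩ : ∃ m, n = m + 1 := ⟨n - 1, by omega⟩
  have hIgs : Ig = I ⊔ Ideal.span {g} := by
    rw [hIg, hI, range_fin_succ_eq_insert, Ideal.span_insert, sup_comm]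
    simp only [Fin.snoc_last, Fin.snoc_castSucc]
  have hIgh : IsHomIdeal Ig := hIg ▸ isHomIdeal_span (isHomogeneous_of_mem_range hfg.1)
  have hg : g.IsHomogeneous D := by simpa using hfg.1 (Fin.last (n + 1))
  have hle : I ≤ Ig := hIgs ▸ le_sup_left
  have hproj : IsGenericSeq F (Fin.snoc d D : Fin (n + 2) → ℕ)
      (Fin.snoc (fun i => projMap K (n + 1) (f i)) (projMap K (n + 1) g) :
        Fin (n + 2) → MvPolynomial (Fin (n + 1)) K) := by
    convert hfg.projMap using 1
    funext i
    refine Fin.lastCases ?_ (fun j => ?_) i <;> simp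
  have hJs : J = Ideal.span (Set.range fun i => projMap K (n + 1) (f i)) := by
    rw [hJ, hI, map_projMap_span_range]
  have hJh : IsHomIdeal J := hJs ▸ isHomIdeal_span (isHomogeneous_of_mem_range hproj.init.1)
  have hJg : Ig.map (projMap K (n + 1)) = J ⊔ Ideal.span {projMap K (n + 1) g} := by
    rw [hIgs, Ideal.map_sup, ← hJ, Ideal.map_span, Set.image_singleton]
  have hsum : ∑ j, d j = ∑ j : Fin n, d j.castSucc + d (Fin.last n) := Fin.sum_univ_castSucc d
  have hsum_ge : n ≤ ∑ j : Fin n, d j.castSucc := by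
    simpa using Finset.sum_le_sum fun (j : Fin n) (_ : j ∈ Finset.univ) => hd j.castSucc
  have hδs' : δs = ∑ j : Fin n, d j.castSucc - n := by
    rw [hδs, Finset.sum_filter, Fin.sum_univ_castSucc]
    simp
  have hlarge : ∀ t, σ < t →
      ∑ j : Fin n, d j.castSucc + 1 ≤ t + n ∨ ∑ j, d j ≤ 2 * t + n := by
    intro t ht
    rw [hσ, min_lt_iff] at ht
    have := hd (Fin.last n)
    omega
  intro μ hμ m hm hmax ν hν hνm
  obtain ⟨ν, rfl⟩ := exists_embExp_eq (hνm _ (Fin.le_last m))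
  rw [monomial_embExp_mem_initialIdeal_iff hIgh]
  rw [expDeg_embExp] at hν
  have hνh := hν ▸ isHomogeneous_monomial_expDeg ν (1 : K)
  induction m using Fin.lastCases with
  | last =>
    by_cases ht : 2 * expDeg μ + (n + 1) < ∑ j, d j + D
    · obtain ⟨p, hp, hph, hpμ⟩ := exists_homogeneous_of_monomial_mem_initialIdeal hIgh hμ.1
      have hker : p ∈ RingHom.ker (projMap K (n + 1)) :=
        projMap_eq_zero_of_isLeadExp hph hpμ hm
      rw [ker_projMap] at hker
      obtain ⟨q, rfl⟩ := Ideal.mem_span_singleton'.1 hker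
      have hq : q ∈ Ig := by
        rw [hIgs, hI] at hp ⊢
        exact mem_of_mul_X_last_mem n.succ_pos hfg hph ht hp
      refine absurd (monomial_mem_initialIdeal_iff.2 ⟨q, hq, isLeadExp_of_mul_X hpμ hm⟩)
        (hμ.2 _ tsub_le_self fun h => ?_)
      have := DFunLike.congr_fun h (Fin.last (n + 1))
      rw [Finsupp.tsub_apply, Finsupp.single_eq_same] at this
      omega
    · refine monomial_mem_initialIdeal_of_mem ?_
      rw [hJg, hJs]
      exact (maximalRank_generic n.succ_pos hproj).2 _ _ hνh (not_lt.1 ht)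
  | cast m =>
    obtain ⟨μ, rfl⟩ := exists_embExp_eq (hmax _ (Fin.castSucc_lt_last m))
    rw [expDeg_embExp] at hν
    simp only [embExp_castSucc] at hm
    have hmax' : ∀ j, m < j → μ j = 0 := fun j hj => by
      simpa only [embExp_castSucc] using hmax j.castSucc (Fin.castSucc_lt_castSucc_iff.2 hj)
    have hνm' : ∀ j, m ≤ j → ν j = 0 := fun j hj => by
      simpa only [embExp_castSucc] using hνm j.castSucc (Fin.castSucc_le_castSucc_iff.2 hj)
    have hJle : initialIdeal J ≤ initialIdeal (Ig.map (projMap K (n + 1))) :=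
      initialIdeal_mono (hJg ▸ le_sup_left)
    by_cases hμJ : monomial μ (1 : K) ∈ initialIdeal J
    · subst hJ
      exact hJle (hE μ (isMinGen_of_embExp hIgh hle hμ hμJ) m hm hmax' ν hν hνm')
    refine hJle ?_
    have hμg := (monomial_embExp_mem_initialIdeal_iff hIgh).1 hμ.1
    rw [hJg] at hμg
    have hgh := isHomogeneous_projMap hg
    obtain ⟨p, hp, hph, hpμ⟩ := exists_homogeneous_of_monomial_mem_initialIdeal
      (hJh.sup (isHomIdeal_span_singleton hgh)) hμg
    obtain ⟨b, hb, hb0, hbJ⟩ := hJh.exists_homogeneous_cofactor hgh hph hp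
    have hb_ne : b ≠ 0 := by
      rintro rfl
      rw [zero_mul, sub_zero] at hbJ
      exact hμJ (monomial_mem_initialIdeal_iff.2 ⟨p, hbJ, hpμ⟩)
    have hDt : D ≤ expDeg μ := not_lt.1 fun h => hb_ne (hb0 h)
    rw [hJs] at hbJ ⊢
    rcases (hσD.trans hDt).lt_or_eq with hlt | heq
    · exact monomial_mem_initialIdeal_of_generic hproj.init (Nat.zero_lt_of_lt hlt)
        (hlarge _ hlt) hν (hνm' _ (Fin.le_last m))
    · have hμD : expDeg μ = D := by omega
      rw [hμD, Nat.sub_self] at hb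
      obtain ⟨c, rfl⟩ : ∃ c, b = C c :=
        ⟨_, totalDegree_eq_zero_iff_eq_C.1 (Nat.le_zero.1 hb.totalDegree_le)⟩
      refine monomial_mem_initialIdeal_of_generic_lead hproj (hμD ▸ hph) hpμ
        (Or.inr ⟨hν.symm, m, ?_, fun j hj => ?_⟩) (hν.trans hμD)
        (fun h => hb_ne (by rw [h, C_0])) hbJ
      · rw [hνm' m le_rfl]
        exact Nat.pos_of_ne_zero hm
      · rw [hmax' j hj, hνm' j hj.le]
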